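/- arXiv:1712.04208 — 2 statements merged into one kernel-verified Lean document; each statement's English description precedes it below -/
import Mathlib

section
/- Let a ≥ 0, b ≥ 1 and let E ⊆ ⋃_{n≥1} B_n^{a,b} be an identity block. For every 1 ≤ p ≤ ∞ with conjugate exponent p′ (1/p + 1/p′ = 1) and every n ∈ ℕ, one has α_{p,n}(E) ≤ β_{p′,n}(E*) ≤ 2b·α_{p,n}(E) and α_{p,n}(E*) ≤ β_{p′,n}(E) ≤ 2b·α_{p,n}(E*). -/
open scoped BigOperators ENNReal

noncomputable section

namespace AsymSeminorms

variable {𝕜 : Type*} [RCLike 𝕜]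

/-- A pair of seminorms on `𝕜^n`, used to encode a (finite) basic sequence together with
the seminorm induced by an operator. -/
abbrev SNPair (𝕜 : Type*) [RCLike 𝕜] (n : ℕ) : Type _ :=
  Seminorm 𝕜 (Fin n → 𝕜) × Seminorm 𝕜 (Fin n → 𝕜)

/-- Truncation of a vector in `𝕜^n` to its first `m` coordinates (the rest set to `0`);
this encodes `∑_{i=1}^m a_i e_i`. -/
def trunc {n : ℕ} (m : ℕ) (a : Fin n → 𝕜) : Fin n → 𝕜 :=
  fun i => if (i : ℕ) < m then a i else 0

/-- Membership in the set `B_n^{a,b}` (here the constants are called `ca`, `cb`):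
`r = P.1` is a norm with `r(e_i) = 1`, both seminorms satisfy the `b`-basis inequality for
truncations, and `ρ = P.2` satisfies `ρ ≤ a·r`. -/
structure MemB (ca cb : ℝ) {n : ℕ} (P : SNPair 𝕜 n) : Prop where
  eq_zero_of : ∀ x : Fin n → 𝕜, P.1 x = 0 → x = 0
  single_eq_one : ∀ i : Fin n, P.1 (Pi.single i 1) = 1
  trunc_fst : ∀ m : ℕ, m ≤ n → ∀ a : Fin n → 𝕜, P.1 (trunc m a) ≤ cb * P.1 a
  trunc_snd : ∀ m : ℕ, m ≤ n → ∀ a : Fin n → 𝕜, P.2 (trunc m a) ≤ cb * P.2 a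
  snd_le : ∀ x : Fin n → 𝕜, P.2 x ≤ ca * P.1 x

/-- The metric `d_n` on `B_n^{a,b}`: the supremum, over coefficient vectors in the unit ball
of `ℓ_∞^n`, of the maximal deviation of the two seminorms. -/
def dB {n : ℕ} (P Q : SNPair 𝕜 n) : ℝ :=
  sSup {x : ℝ | ∃ a : Fin n → 𝕜, (∀ i, ‖a i‖ ≤ 1) ∧
      x = max |P.1 a - Q.1 a| |P.2 a - Q.2 a|}

/-- A family `E`, with `E n` a set of pairs of seminorms on `𝕜^n`; this encodes a subset of
`⋃_{n≥1} B_n^{a,b}`. -/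
abbrev Fam (𝕜 : Type*) [RCLike 𝕜] : Type _ := ∀ n : ℕ, Set (SNPair 𝕜 n)

/-- `E ⊆ ⋃_n B_n^{a,b}`. -/
def SubB (ca cb : ℝ) (E : Fam 𝕜) : Prop := ∀ n, ∀ P ∈ E n, MemB ca cb P

/-- `E` is closed: each `E ∩ B_n^{a,b}` is closed in `B_n^{a,b}` for the metric `d_n`. -/
def ClosedFam (ca cb : ℝ) (E : Fam 𝕜) : Prop :=
  ∀ n, ∀ P : SNPair 𝕜 n, MemB ca cb P →
    (∀ ε : ℝ, 0 < ε → ∃ Q ∈ E n, dB P Q < ε) → P ∈ E n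

/-- The `j`-th block piece: the vector `∑_{k_j < i ≤ k_{j+1}} a_i e_i` (with `0`-based
indexing of the cut points `k`). -/
def piece {n m : ℕ} (a : Fin n → 𝕜) (k : Fin (m + 1) → ℕ) (j : Fin m) : Fin n → 𝕜 :=
  fun i => if k j.castSucc ≤ (i : ℕ) ∧ (i : ℕ) < k j.succ then a i else 0

/-- `(s,σ) = Q` is a block of `(r,ρ) = P`. -/
def IsBlockOf {n m : ℕ} (P : SNPair 𝕜 n) (Q : SNPair 𝕜 m) : Prop :=
  ∃ (a : Fin n → 𝕜) (k : Fin (m + 1) → ℕ),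
    k 0 = 0 ∧ StrictMono k ∧ k (Fin.last m) ≤ n ∧
    (∀ j : Fin m, P.1 (piece a k j) = 1) ∧
    (∀ b : Fin m → 𝕜, Q.1 b = P.1 (∑ j : Fin m, b j • piece a k j)) ∧
    (∀ b : Fin m → 𝕜, Q.2 b = P.2 (∑ j : Fin m, b j • piece a k j))

/-- `E` contains all blocks of its members (that lie in the corresponding `B_m^{a,b}`). -/
def BlockClosedFam (ca cb : ℝ) (E : Fam 𝕜) : Prop :=
  ∀ n m : ℕ, ∀ P ∈ E n, ∀ Q : SNPair 𝕜 m, MemB ca cb Q → IsBlockOf P Q → Q ∈ E m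

/-- `E ⊆ ⋃_n B_n^{a,b}` is stable: closed and block closed. -/
def StableFam (ca cb : ℝ) (E : Fam 𝕜) : Prop :=
  SubB ca cb E ∧ ClosedFam ca cb E ∧ BlockClosedFam ca cb E

/-- `E` is an identity block: stable and `r = ρ` for each member. -/
def IdentityBlockFam (ca cb : ℝ) (E : Fam 𝕜) : Prop :=
  StableFam ca cb E ∧ ∀ n, ∀ P ∈ E n, P.1 = P.2

/-- The `ℓ_p^n` norm of a coefficient vector, `1 ≤ p ≤ ∞`. -/
def lpnorm (p : ℝ≥0∞) {n : ℕ} (a : Fin n → 𝕜) : ℝ :=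
  if p = ∞ then ⨆ i, ‖a i‖ else (∑ i, ‖a i‖ ^ p.toReal) ^ (1 / p.toReal)

/-- The sign `±1 ∈ 𝕜` associated to a Boolean. -/
def sgn (b : Bool) : 𝕜 := if b then 1 else -1

/-- The `L_p` norm of a real function of `n` independent Rademacher variables, i.e. of a
function on `{±1}^n` with the uniform probability measure. -/
def radLp (p : ℝ≥0∞) {n : ℕ} (F : (Fin n → Bool) → ℝ) : ℝ :=
  if p = ∞ then ⨆ ε : Fin n → Bool, |F ε|
  else ((∑ ε : Fin n → Bool, |F ε| ^ p.toReal) / 2 ^ n) ^ (1 / p.toReal)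

/-- `α_{p,n}(E)`: the infimum of the constants `T > 0` such that
`ρ(∑ a_i e_i) ≤ T ‖(a_i)‖_{ℓ_p^n}` for all `(r,ρ) ∈ E ∩ B_n^{a,b}`. -/
def alphaC (p : ℝ≥0∞) (E : Fam 𝕜) (n : ℕ) : ℝ :=
  sInf {T : ℝ | 0 < T ∧ ∀ P ∈ E n, ∀ a : Fin n → 𝕜, P.2 a ≤ T * lpnorm p a}

/-- `β_{q,n}(E)`: the infimum of the constants `C > 0` such that
`C r(∑ a_i e_i) ≥ ‖(a_i ρ(e_i))‖_{ℓ_q^n}` for all `(r,ρ) ∈ E ∩ B_n^{a,b}`. -/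
def betaC (q : ℝ≥0∞) (E : Fam 𝕜) (n : ℕ) : ℝ :=
  sInf {C : ℝ | 0 < C ∧ ∀ P ∈ E n, ∀ a : Fin n → 𝕜,
    lpnorm q (fun i => a i * ((P.2 (Pi.single i 1) : ℝ) : 𝕜)) ≤ C * P.1 a}

/-- `τ_{p,n}(E)`: the infimum of the constants `T > 0` such that
`‖ρ(∑ ε_i a_i e_i)‖_{L_p} ≤ T ‖(a_i)‖_{ℓ_p^n}` for all `(r,ρ) ∈ E ∩ B_n^{a,b}`. -/
def tauC (p : ℝ≥0∞) (E : Fam 𝕜) (n : ℕ) : ℝ :=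
  sInf {T : ℝ | 0 < T ∧ ∀ P ∈ E n, ∀ a : Fin n → 𝕜,
    radLp p (fun ε => P.2 (fun i => sgn (ε i) * a i)) ≤ T * lpnorm p a}

/-- `γ_{q,n}(E)`: the infimum of the constants `C > 0` such that
`C ‖r(∑ ε_i a_i e_i)‖_{L_q} ≥ ‖(a_i ρ(e_i))‖_{ℓ_q^n}` for all `(r,ρ) ∈ E ∩ B_n^{a,b}`. -/
def gammaC (q : ℝ≥0∞) (E : Fam 𝕜) (n : ℕ) : ℝ :=
  sInf {C : ℝ | 0 < C ∧ ∀ P ∈ E n, ∀ a : Fin n → 𝕜,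
    lpnorm q (fun i => a i * ((P.2 (Pi.single i 1) : ℝ) : 𝕜)) ≤
      C * radLp q (fun ε => P.1 (fun i => sgn (ε i) * a i))}

/-- `θ_n(E)`: the infimum of the constants `T > 0` such that
`ρ((1/n) ∑ a_i e_i) ≤ T ‖(a_i)‖_{ℓ_∞^n}` for all `(r,ρ) ∈ E ∩ B_n^{a,b}`. -/
def thetaC (E : Fam 𝕜) (n : ℕ) : ℝ :=
  sInf {T : ℝ | 0 < T ∧ ∀ P ∈ E n, ∀ a : Fin n → 𝕜,
    P.2 ((n : 𝕜)⁻¹ • a) ≤ T * lpnorm ∞ a}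

/-- `Θ_n(E)`: the infimum of the constants `T > 0` such that
`‖ρ((1/n) ∑ ε_i a_i e_i)‖_{L_1} ≤ T ‖(a_i)‖_{ℓ_∞^n}` for all `(r,ρ) ∈ E ∩ B_n^{a,b}`. -/
def bigThetaC (E : Fam 𝕜) (n : ℕ) : ℝ :=
  sInf {T : ℝ | 0 < T ∧ ∀ P ∈ E n, ∀ a : Fin n → 𝕜,
    radLp 1 (fun ε => P.2 ((n : 𝕜)⁻¹ • fun i => sgn (ε i) * a i)) ≤ T * lpnorm ∞ a}

/-- `υ_n(E)`: the infimum of the constants `C > 0` such that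
`C r(∑ a_i e_i) ≥ min_i |a_i| ρ(e_i)` for all `(r,ρ) ∈ E ∩ B_n^{a,b}`. -/
def upsC (E : Fam 𝕜) (n : ℕ) : ℝ :=
  sInf {C : ℝ | 0 < C ∧ ∀ P ∈ E n, ∀ a : Fin n → 𝕜,
    (⨅ i, ‖a i‖ * P.2 (Pi.single i 1)) ≤ C * P.1 a}

/-- `Υ_n(E)`: the infimum of the constants `C > 0` such that
`C ‖r(∑ ε_i a_i e_i)‖_{L_1} ≥ min_i |a_i| ρ(e_i)` for all `(r,ρ) ∈ E ∩ B_n^{a,b}`. -/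
def bigUpsC (E : Fam 𝕜) (n : ℕ) : ℝ :=
  sInf {C : ℝ | 0 < C ∧ ∀ P ∈ E n, ∀ a : Fin n → 𝕜,
    (⨅ i, ‖a i‖ * P.2 (Pi.single i 1)) ≤
      C * radLp 1 (fun ε => P.1 (fun i => sgn (ε i) * a i))}

end AsymSeminorms

namespace AsymSeminorms

variable {𝕜 : Type*} [RCLike 𝕜]

/-- The dual norm, on coefficient vectors `f` representing the functional
`∑ f_i e_i^*` on `(𝕜^n, r)`. -/
def dualNorm {n : ℕ} (r : Seminorm 𝕜 (Fin n → 𝕜)) (f : Fin n → 𝕜) : ℝ :=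
  sSup {t : ℝ | ∃ x : Fin n → 𝕜, r x ≤ 1 ∧ t = ‖∑ i, f i * x i‖}

/-- Membership in `E^(*)`: `Q` is the (identity) pair induced by a normalized block
sequence, of length `n`, of the biorthogonal functionals `(e_i^*)_{i=1}^m` of some member
`(r,r) ∈ E ∩ B_m^{a,b}`.  The blocks are `piece c k j`, normalized in the dual norm of `r`. -/
def MemDualBlocks (E : Fam 𝕜) {n : ℕ} (Q : SNPair 𝕜 n) : Prop :=
  ∃ (m : ℕ) (P : SNPair 𝕜 m), P ∈ E m ∧
    ∃ (c : Fin m → 𝕜) (k : Fin (n + 1) → ℕ),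
      k 0 = 0 ∧ StrictMono k ∧ k (Fin.last n) ≤ m ∧
      (∀ j : Fin n, 0 < dualNorm P.1 (piece c k j)) ∧
      Q.1 = Q.2 ∧
      ∀ b : Fin n → 𝕜,
        Q.1 b = dualNorm P.1
          (∑ j : Fin n, b j • ((dualNorm P.1 (piece c k j))⁻¹ • piece c k j))

/-- `E^* = ⋃_n E_n^*`, where `E_n^*` is the `d_n`-closure of `E^(*) ∩ B_n^{a,b}` inside
`B_n^{a,b}`. -/
def dualFam (ca cb : ℝ) (E : Fam 𝕜) : Fam 𝕜 := fun n =>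
  {P : SNPair 𝕜 n | MemB ca cb P ∧
    ∀ ε : ℝ, 0 < ε → ∃ Q : SNPair 𝕜 n, MemDualBlocks E Q ∧ MemB ca cb Q ∧ dB P Q < ε}

section LpNorm

variable {n : ℕ} {p q : ℝ≥0∞}

lemma lpnorm_top (a : Fin n → 𝕜) : lpnorm ∞ a = ⨆ i, ‖a i‖ := if_pos rfl

lemma lpnorm_of_ne_top (hp : p ≠ ∞) (a : Fin n → 𝕜) :
    lpnorm p a = (∑ i, ‖a i‖ ^ p.toReal) ^ (1 / p.toReal) := if_neg hp

lemma lpnorm_one (a : Fin n → 𝕜) : lpnorm 1 a = ∑ i, ‖a i‖ := by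
  simp [lpnorm_of_ne_top ENNReal.one_ne_top]

lemma lpnorm_nonneg (p : ℝ≥0∞) (a : Fin n → 𝕜) : 0 ≤ lpnorm p a := by
  unfold lpnorm
  split_ifs
  · exact Real.iSup_nonneg fun i => norm_nonneg _
  · positivity

lemma norm_le_lpnorm (hp : 1 ≤ p) (a : Fin n → 𝕜) (i : Fin n) : ‖a i‖ ≤ lpnorm p a := by
  rcases eq_or_ne p ∞ with rfl | hp'
  · rw [lpnorm_top]
    exact le_ciSup (f := fun i => ‖a i‖) (Set.finite_range _).bddAbove i
  · have h0 : 0 < p.toReal := ENNReal.toReal_pos (by positivity) hp'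
    rw [lpnorm_of_ne_top hp', one_div, Real.le_rpow_inv_iff_of_pos (norm_nonneg _)
      (by positivity) h0]
    exact Finset.single_le_sum (f := fun i => ‖a i‖ ^ p.toReal) (fun _ _ => by positivity)
      (Finset.mem_univ i)

/-- The `ℓ_p` norm is monotone in the absolute values of the coordinates, up to scaling. -/
lemma lpnorm_le_mul (hp : 1 ≤ p) {𝕜' : Type*} [RCLike 𝕜'] {K : ℝ} (hK : 0 ≤ K)
    {a : Fin n → 𝕜} {b : Fin n → 𝕜'}
    (h : ∀ i, ‖a i‖ ≤ K * ‖b i‖) : lpnorm p a ≤ K * lpnorm p b := by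
  rcases eq_or_ne p ∞ with rfl | hp'
  · rw [lpnorm_top]
    refine Real.iSup_le (fun i => (h i).trans ?_) (mul_nonneg hK (lpnorm_nonneg _ _))
    exact mul_le_mul_of_nonneg_left (norm_le_lpnorm hp b i) hK
  · have h0 : 0 < p.toReal := ENNReal.toReal_pos (by positivity) hp'
    rw [lpnorm_of_ne_top hp', lpnorm_of_ne_top hp']
    calc (∑ i, ‖a i‖ ^ p.toReal) ^ (1 / p.toReal)
        ≤ (∑ i, (K * ‖b i‖) ^ p.toReal) ^ (1 / p.toReal) := by
          gcongr with i
          exact h i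
      _ = (K ^ p.toReal * ∑ i, ‖b i‖ ^ p.toReal) ^ (1 / p.toReal) := by
          simp_rw [Real.mul_rpow hK (norm_nonneg _), ← Finset.mul_sum]
      _ = K * (∑ i, ‖b i‖ ^ p.toReal) ^ (1 / p.toReal) := by
          rw [Real.mul_rpow (by positivity) (by positivity), ← Real.rpow_mul hK,
            mul_one_div_cancel h0.ne', Real.rpow_one]

lemma holderConjugate_cases (hpq : p.HolderConjugate q) :
    (p = 1 ∧ q = ∞) ∨ (p = ∞ ∧ q = 1) ∨
      (p ≠ ∞ ∧ q ≠ ∞ ∧ p.toReal.HolderConjugate q.toReal) := by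
  have key := hpq.inv_add_inv_eq_inv
  rw [inv_one] at key
  by_cases hp : p = ∞
  · right; left
    subst hp
    simpa using key
  by_cases hq : q = ∞
  · left
    subst hq
    simpa using key
  · exact Or.inr (Or.inr ⟨hp, hq, ENNReal.HolderConjugate.toReal_of_ne_top hp hq⟩)

lemma sum_norm_mul_le (hpq : p.HolderConjugate q) (a b : Fin n → 𝕜) :
    ∑ i, ‖a i‖ * ‖b i‖ ≤ lpnorm p a * lpnorm q b := by
  rcases holderConjugate_cases hpq with ⟨rfl, rfl⟩ | ⟨rfl, rfl⟩ | ⟨hp, hq, h⟩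
  · rw [lpnorm_one, Finset.sum_mul]
    gcongr with i
    exact norm_le_lpnorm (by simp) b i
  · rw [lpnorm_one, Finset.mul_sum]
    gcongr with i
    exact norm_le_lpnorm (by simp) a i
  · rw [lpnorm_of_ne_top hp, lpnorm_of_ne_top hq]
    exact Real.inner_le_Lp_mul_Lq_of_nonneg _ h (fun _ _ => norm_nonneg _)
      (fun _ _ => norm_nonneg _)

lemma norm_sum_mul_le (hpq : p.HolderConjugate q) (a b : Fin n → 𝕜) :
    ‖∑ i, a i * b i‖ ≤ lpnorm p a * lpnorm q b :=
  (norm_sum_le _ _).trans (by simpa only [norm_mul] using sum_norm_mul_le hpq a b)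

lemma exists_norm_eq_one_mul_eq (z : 𝕜) : ∃ u : 𝕜, ‖u‖ = 1 ∧ u * z = (‖z‖ : 𝕜) := by
  obtain ⟨u, hu, h⟩ := RCLike.exists_norm_eq_mul_self z
  exact ⟨u, hu, h.symm⟩

/-- The converse of Hölder's inequality. -/
lemma lpnorm_le_of_forall_norm_sum_le (hpq : p.HolderConjugate q) {K : ℝ} (hK : 0 ≤ K)
    (b : Fin n → 𝕜) (h : ∀ a : Fin n → 𝕜, ‖∑ i, a i * b i‖ ≤ K * lpnorm p a) :
    lpnorm q b ≤ K := by
  have hreal : ∀ g : Fin n → ℝ, (∀ i, 0 ≤ g i) → ∑ i, ‖b i‖ * g i ≤ K * lpnorm p g := by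
    intro g hg
    choose u hu hub using fun i => exists_norm_eq_one_mul_eq (b i)
    have h1 := h fun i => (g i : 𝕜) * u i
    have h2 : ∑ i, (g i : 𝕜) * u i * b i = ((∑ i, ‖b i‖ * g i : ℝ) : 𝕜) := by
      push_cast
      refine Finset.sum_congr rfl fun i _ => ?_
      rw [mul_assoc, hub, mul_comm]
    have h3 : lpnorm p (fun i => (g i : 𝕜) * u i) ≤ 1 * lpnorm p g :=
      lpnorm_le_mul (ENNReal.HolderConjugate.one_le p q) zero_le_one fun i => by simp [hu]
    rw [one_mul] at h3
    rw [h2, RCLike.norm_ofReal] at h1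
    exact (le_abs_self _).trans (h1.trans (mul_le_mul_of_nonneg_left h3 hK))
  rcases holderConjugate_cases hpq with ⟨rfl, rfl⟩ | ⟨rfl, rfl⟩ | ⟨hp, hq, hc⟩
  · rw [lpnorm_top]
    refine Real.iSup_le (fun i => ?_) hK
    have := hreal (Pi.single i 1) fun j => by
      rcases eq_or_ne j i with rfl | hj <;> simp [*]
    simpa [lpnorm_one, Pi.single_apply, apply_ite norm] using this
  · rw [lpnorm_one]
    have := hreal 1 (by simp)
    refine (by simpa using this : _ ≤ K * lpnorm ∞ (1 : Fin n → ℝ)).trans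
      (mul_le_of_le_one_right hK ?_)
    rw [lpnorm_top]
    exact Real.iSup_le (fun i => by simp) zero_le_one
  · obtain ⟨⟨g, hg, hgf⟩, -⟩ :=
      NNReal.isGreatest_Lp Finset.univ (fun i => ‖b i‖₊) (p := q.toReal) (q := p.toReal) hc.symm
    have hb : lpnorm q b = ∑ i, ‖b i‖ * (g i : ℝ) := by
      rw [lpnorm_of_ne_top hq]
      have := congrArg NNReal.toReal hgf
      push_cast at this
      exact this.symm
    rw [hb]
    refine (hreal (fun i => g i) fun i => (g i).2).trans (mul_le_of_le_one_right hK ?_)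
    rw [lpnorm_of_ne_top hp]
    refine Real.rpow_le_one (by positivity) ?_ (by positivity)
    have : ∑ i, g i ^ p.toReal ≤ 1 := hg
    have := NNReal.coe_le_coe.2 this
    push_cast at this
    simpa using this

end LpNorm

section DualNorm

variable {ca cb : ℝ} {n m : ℕ}

/-- A vector on which a seminorm is attained by a dominated linear functional. -/
lemma exists_dual_eq_seminorm {F : Type*} [AddCommGroup F] [Module 𝕜 F] (r : Seminorm 𝕜 F)
    (x : F) : ∃ g : Module.Dual 𝕜 F, g x = (r x : 𝕜) ∧ ∀ y, ‖g y‖ ≤ r y := by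
  let : SeminormedAddCommGroup F := r.toAddGroupSeminorm.toSeminormedAddCommGroup
  let : NormedSpace 𝕜 F := ⟨fun c y => (map_smul_eq_mul r c y).le⟩
  obtain ⟨g, hg, hgx⟩ := exists_dual_vector'' 𝕜 x
  exact ⟨g.toLinearMap, hgx, fun y => (g.le_of_opNorm_le hg y).trans (one_mul ‖y‖).le⟩

lemma seminorm_le_sum (r : Seminorm 𝕜 (Fin n → 𝕜)) (x : Fin n → 𝕜) :
    r x ≤ ∑ i, ‖x i‖ * r (Pi.single i 1) := by
  conv_lhs => rw [pi_eq_sum_univ' x]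
  refine (Finset.le_sum_of_subadditive r (map_zero r).le (map_add_le_add r) _ _).trans_eq ?_
  simp only [map_smul_eq_mul]

lemma trunc_eq_self (x : Fin n → 𝕜) : trunc n x = x := by
  ext i
  simp [trunc]

lemma piece_eq_trunc_sub (c : Fin m → 𝕜) (k : Fin (n + 1) → ℕ) (hk : StrictMono k) (j : Fin n) :
    piece c k j = trunc (k j.succ) c - trunc (k j.castSucc) c := by
  ext i
  have := hk j.castSucc_lt_succ
  simp only [piece, trunc, Pi.sub_apply]
  split_ifs <;> first | omega | simp

lemma MemB.map_piece_le {P : SNPair 𝕜 m} (hP : MemB ca cb P) (c : Fin m → 𝕜)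
    {k : Fin (n + 1) → ℕ} (hk : StrictMono k) (hkm : k (Fin.last n) ≤ m) (j : Fin n) :
    P.1 (piece c k j) ≤ 2 * cb * P.1 c := by
  have hle : ∀ l, k l ≤ m := fun l => (hk.monotone (Fin.le_last l)).trans hkm
  rw [piece_eq_trunc_sub c k hk]
  linarith [map_sub_le_add P.1 (trunc (k j.succ) c) (trunc (k j.castSucc) c),
    hP.trunc_fst _ (hle j.succ) c, hP.trunc_fst _ (hle j.castSucc) c]

lemma piece_val (c : Fin n → 𝕜) (j : Fin n) :
    piece c (fun i : Fin (n + 1) => (i : ℕ)) j = Pi.single j (c j) := by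
  ext i
  simp only [piece, Fin.val_castSucc, Fin.val_succ, Pi.single_apply]
  rcases eq_or_ne i j with rfl | h
  · simp
  · rw [if_neg h, if_neg]
    rw [Ne, Fin.ext_iff] at h
    omega

lemma single_eq_smul (i : Fin n) (z : 𝕜) : Pi.single i z = z • (Pi.single i 1 : Fin n → 𝕜) := by
  ext j
  simp [Pi.single_apply]

lemma MemB.norm_apply_le {P : SNPair 𝕜 n} (hP : MemB ca cb P) (x : Fin n → 𝕜) (i : Fin n) :
    ‖x i‖ ≤ 2 * cb * P.1 x := by
  have h := hP.map_piece_le x (k := fun i : Fin (n + 1) => (i : ℕ)) Fin.val_strictMono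
    (by simp) i
  rwa [piece_val, single_eq_smul, map_smul_eq_mul, hP.single_eq_one, mul_one] at h

lemma MemB.le_sum {P : SNPair 𝕜 n} (hP : MemB ca cb P) (x : Fin n → 𝕜) :
    P.1 x ≤ ∑ i, ‖x i‖ := by
  simpa [hP.single_eq_one] using seminorm_le_sum P.1 x

lemma continuous_seminorm_pi (r : Seminorm 𝕜 (Fin n → 𝕜)) : Continuous r := by
  refine Seminorm.continuous_of_continuousAt_zero ?_
  rw [ContinuousAt, map_zero]
  have h : Filter.Tendsto (fun x : Fin n → 𝕜 => ∑ i, ‖x i‖ * r (Pi.single i 1)) (nhds 0)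
      (nhds 0) := by
    have : Continuous fun x : Fin n → 𝕜 => ∑ i, ‖x i‖ * r (Pi.single i 1) := by fun_prop
    simpa using this.tendsto 0
  exact squeeze_zero (fun x => apply_nonneg r x) (seminorm_le_sum r) h

/-- The dual norm is attained. -/
lemma MemB.exists_dualNorm_eq {P : SNPair 𝕜 n} (hP : MemB ca cb P) (f : Fin n → 𝕜) :
    ∃ x, P.1 x ≤ 1 ∧ ‖∑ i, f i * x i‖ = dualNorm P.1 f ∧
      ∀ y, P.1 y ≤ 1 → ‖∑ i, f i * y i‖ ≤ dualNorm P.1 f := by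
  have hcomp : IsCompact {x : Fin n → 𝕜 | P.1 x ≤ 1} := by
    refine Metric.isCompact_of_isClosed_isBounded
      (isClosed_le (continuous_seminorm_pi P.1) continuous_const) ?_
    refine (Metric.isBounded_closedBall (x := (0 : Fin n → 𝕜)) (r := 2 * |cb|)).subset ?_
    intro x hx
    rw [mem_closedBall_zero_iff, pi_norm_le_iff_of_nonneg (by positivity)]
    intro i
    refine (hP.norm_apply_le x i).trans ?_
    have h0 := apply_nonneg P.1 x
    have h1 : P.1 x ≤ 1 := hx
    nlinarith [le_abs_self cb, abs_nonneg cb]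
  obtain ⟨x, hx, hmax⟩ := hcomp.exists_isMaxOn ⟨0, by simp⟩
    (f := fun x => ‖∑ i, f i * x i‖) (by fun_prop)
  have hg : IsGreatest {t : ℝ | ∃ x : Fin n → 𝕜, P.1 x ≤ 1 ∧ t = ‖∑ i, f i * x i‖}
      ‖∑ i, f i * x i‖ :=
    ⟨⟨x, hx, rfl⟩, by rintro _ ⟨y, hy, rfl⟩; exact hmax hy⟩
  have he : dualNorm P.1 f = ‖∑ i, f i * x i‖ := hg.csSup_eq
  exact ⟨x, hx, he.symm, fun y hy => he ▸ hmax hy⟩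

lemma MemB.norm_sum_mul_le_dualNorm {P : SNPair 𝕜 n} (hP : MemB ca cb P) (f x : Fin n → 𝕜) :
    ‖∑ i, f i * x i‖ ≤ dualNorm P.1 f * P.1 x := by
  rcases eq_or_ne (P.1 x) 0 with h0 | h0
  · simp [hP.eq_zero_of x h0]
  obtain ⟨-, -, -, h⟩ := hP.exists_dualNorm_eq f
  have hpos : 0 < P.1 x := lt_of_le_of_ne (apply_nonneg _ _) h0.symm
  have h1 := h ((((P.1 x)⁻¹ : ℝ) : 𝕜) • x) (by
    rw [map_smul_eq_mul, RCLike.norm_ofReal, abs_of_pos (by positivity), inv_mul_cancel₀ h0])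
  have h2 : ∑ i, f i * ((((P.1 x)⁻¹ : ℝ) : 𝕜) • x) i
      = (((P.1 x)⁻¹ : ℝ) : 𝕜) * ∑ i, f i * x i := by
    rw [Finset.mul_sum]
    refine Finset.sum_congr rfl fun i _ => ?_
    simp only [Pi.smul_apply, smul_eq_mul]
    ring
  rw [h2, norm_mul, RCLike.norm_ofReal, abs_of_pos (by positivity)] at h1
  rwa [inv_mul_le_iff₀ hpos, mul_comm] at h1

lemma MemB.dualNorm_nonneg {P : SNPair 𝕜 n} (hP : MemB ca cb P) (f : Fin n → 𝕜) :
    0 ≤ dualNorm P.1 f := by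
  obtain ⟨x, -, h, -⟩ := hP.exists_dualNorm_eq f
  exact h ▸ norm_nonneg _

lemma MemB.dualNorm_le {P : SNPair 𝕜 n} (hP : MemB ca cb P) {f : Fin n → 𝕜} {K : ℝ}
    (h : ∀ x, ‖∑ i, f i * x i‖ ≤ K * P.1 x) (hK : 0 ≤ K) : dualNorm P.1 f ≤ K := by
  obtain ⟨x, hx, he, -⟩ := hP.exists_dualNorm_eq f
  exact he ▸ (h x).trans (mul_le_of_le_one_right hK hx)

/-- The dual norm as a seminorm. -/
def dualSeminorm {P : SNPair 𝕜 n} (hP : MemB ca cb P) : Seminorm 𝕜 (Fin n → 𝕜) :=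
  Seminorm.of (dualNorm P.1)
    (fun f g => hP.dualNorm_le (fun x => by
      simp only [Pi.add_apply, add_mul, Finset.sum_add_distrib]
      exact (norm_add_le _ _).trans
        (add_le_add (hP.norm_sum_mul_le_dualNorm f x) (hP.norm_sum_mul_le_dualNorm g x)))
      (add_nonneg (hP.dualNorm_nonneg f) (hP.dualNorm_nonneg g)))
    (fun c f => by
      have hs : ∀ x : Fin n → 𝕜, ‖∑ i, (c • f) i * x i‖ = ‖c‖ * ‖∑ i, f i * x i‖ := fun x => by
        rw [← norm_mul, Finset.mul_sum]
        simp [mul_assoc]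
      refine le_antisymm (hP.dualNorm_le (fun x => ?_)
        (mul_nonneg (norm_nonneg _) (hP.dualNorm_nonneg f))) ?_
      · rw [hs, mul_assoc]
        exact mul_le_mul_of_nonneg_left (hP.norm_sum_mul_le_dualNorm f x) (norm_nonneg _)
      · obtain ⟨x, hx, he, -⟩ := hP.exists_dualNorm_eq f
        obtain ⟨-, -, -, h⟩ := hP.exists_dualNorm_eq (c • f)
        rw [← he, ← hs]
        exact h x hx)

lemma dualSeminorm_apply {P : SNPair 𝕜 n} (hP : MemB ca cb P) (f : Fin n → 𝕜) :
    dualSeminorm hP f = dualNorm P.1 f := rfl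

/-- Every vector is normed by a functional of dual norm at most one. -/
lemma MemB.exists_norming {P : SNPair 𝕜 n} (hP : MemB ca cb P) (x : Fin n → 𝕜) :
    ∃ f : Fin n → 𝕜, dualNorm P.1 f ≤ 1 ∧ ∑ i, f i * x i = (P.1 x : 𝕜) := by
  obtain ⟨g, hg, hle⟩ := exists_dual_eq_seminorm P.1 x
  have hsum : ∀ y : Fin n → 𝕜, ∑ i, g (Pi.single i 1) * y i = g y := fun y => by
    conv_rhs => rw [pi_eq_sum_univ' y, map_sum]
    simp only [map_smul, smul_eq_mul, mul_comm]
  refine ⟨fun i => g (Pi.single i 1), hP.dualNorm_le (fun y => ?_) zero_le_one, ?_⟩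
  · rw [hsum, one_mul]
    exact hle y
  · rw [hsum, hg]

end DualNorm


section Blocks

variable {ca cb : ℝ} {n m : ℕ} {E : Fam 𝕜}

lemma piece_apply_of_mem {c : Fin m → 𝕜} {k : Fin (n + 1) → ℕ} {j : Fin n} {i : Fin m}
    (h : k j.castSucc ≤ (i : ℕ) ∧ (i : ℕ) < k j.succ) : piece c k j i = c i := if_pos h

lemma piece_apply_of_notMem {c : Fin m → 𝕜} {k : Fin (n + 1) → ℕ} {j : Fin n} {i : Fin m}
    (h : ¬(k j.castSucc ≤ (i : ℕ) ∧ (i : ℕ) < k j.succ)) : piece c k j i = 0 := if_neg h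

lemma eq_of_mem_intervals {k : Fin (n + 1) → ℕ} (hk : StrictMono k) {j l : Fin n} {i : ℕ}
    (hj : k j.castSucc ≤ i ∧ i < k j.succ) (hl : k l.castSucc ≤ i ∧ i < k l.succ) : j = l := by
  have key : ∀ {j l : Fin n}, k j.castSucc ≤ i ∧ i < k j.succ →
      k l.castSucc ≤ i ∧ i < k l.succ → ¬j < l := fun {j l} hj hl h => by
    have := hk.monotone (show j.succ ≤ l.castSucc from Fin.succ_le_castSucc_iff.2 h)
    omega
  exact le_antisymm (not_lt.1 (key hl hj)) (not_lt.1 (key hj hl))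

lemma sum_smul_piece_apply {k : Fin (n + 1) → ℕ} (hk : StrictMono k) (b : Fin n → 𝕜)
    (w : Fin n → Fin m → 𝕜) {j : Fin n} {i : Fin m}
    (h : k j.castSucc ≤ (i : ℕ) ∧ (i : ℕ) < k j.succ) :
    (∑ l, b l • piece (w l) k l) i = b j * w j i := by
  rw [Finset.sum_apply, Finset.sum_eq_single j]
  · simp [piece_apply_of_mem h]
  · intro l _ hl
    rw [Pi.smul_apply, piece_apply_of_notMem, smul_zero]
    exact fun hl' => hl (eq_of_mem_intervals hk hl' h)
  · simp

lemma piece_sum_smul_piece {k : Fin (n + 1) → ℕ} (hk : StrictMono k) (b : Fin n → 𝕜)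
    (w : Fin n → Fin m → 𝕜) (j : Fin n) :
    piece (∑ l, b l • piece (w l) k l) k j = b j • piece (w j) k j := by
  ext i
  by_cases h : k j.castSucc ≤ (i : ℕ) ∧ (i : ℕ) < k j.succ
  · rw [piece_apply_of_mem h, sum_smul_piece_apply hk b w h, Pi.smul_apply, piece_apply_of_mem h,
      smul_eq_mul]
  · rw [piece_apply_of_notMem h, Pi.smul_apply, piece_apply_of_notMem h, smul_zero]

lemma piece_sum_piece {k : Fin (n + 1) → ℕ} (hk : StrictMono k)
    (w : Fin n → Fin m → 𝕜) (j : Fin n) :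
    piece (∑ l, piece (w l) k l) k j = piece (w j) k j := by
  simpa using piece_sum_smul_piece hk 1 w j

lemma trunc_sum_smul_piece {k : Fin (n + 1) → ℕ} (hk : StrictMono k) (b : Fin n → 𝕜)
    (c : Fin m → 𝕜) (l : Fin (n + 1)) :
    trunc (k l) (∑ j, b j • piece c k j) = ∑ j, trunc (l : ℕ) b j • piece c k j := by
  ext i
  simp only [trunc, Finset.sum_apply, Pi.smul_apply, smul_eq_mul]
  have hmono := hk.monotone
  by_cases hi : (i : ℕ) < k l
  · rw [if_pos hi]
    refine Finset.sum_congr rfl fun j _ => ?_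
    split_ifs with hj
    · rfl
    · have : k l ≤ k j.castSucc := hmono (by rw [Fin.le_def]; simpa using hj)
      rw [piece_apply_of_notMem (by omega), mul_zero, mul_zero]
  · rw [if_neg hi]
    refine (Finset.sum_eq_zero fun j _ => ?_).symm
    split_ifs with hj
    · have : k j.succ ≤ k l := hmono (by rw [Fin.le_def, Fin.val_succ]; omega)
      rw [piece_apply_of_notMem (by omega), mul_zero]
    · rw [zero_mul]

lemma sum_piece {k : Fin (n + 1) → ℕ} (hk : StrictMono k) (hk0 : k 0 = 0)
    (hkm : k (Fin.last n) = m) (x : Fin m → 𝕜) : ∑ j, piece x k j = x := by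
  have h1 := Fin.sum_univ_succ fun l => trunc (k l) x
  have h2 := Fin.sum_univ_castSucc fun l => trunc (k l) x
  have h3 : trunc 0 x = 0 := by
    ext
    simp [trunc]
  simp_rw [piece_eq_trunc_sub x k hk, Finset.sum_sub_distrib]
  rw [h1, hk0, hkm, h3, zero_add, trunc_eq_self] at h2
  rw [h2, add_sub_cancel_left]

lemma sum_piece_mul_piece_self {k : Fin (n + 1) → ℕ} (c w : Fin m → 𝕜) (j : Fin n) :
    ∑ i, piece c k j i * piece w k j i = ∑ i, piece c k j i * w i := by
  refine Finset.sum_congr rfl fun i _ => ?_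
  by_cases h : k j.castSucc ≤ (i : ℕ) ∧ (i : ℕ) < k j.succ
  · rw [piece_apply_of_mem (c := w) h]
  · rw [piece_apply_of_notMem (c := c) h, zero_mul, zero_mul]

/-- Normalized blocks of a member of an identity block are again members. -/
lemma IdentityBlockFam.exists_block (hE : IdentityBlockFam ca cb E) {P : SNPair 𝕜 m}
    (hP : P ∈ E m) (c : Fin m → 𝕜) {k : Fin (n + 1) → ℕ} (hk0 : k 0 = 0) (hk : StrictMono k)
    (hkm : k (Fin.last n) ≤ m) (hne : ∀ j, piece c k j ≠ 0) :
    ∃ Q ∈ E n, ∀ b, Q.1 b =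
      P.1 (∑ j, b j • ((((P.1 (piece c k j))⁻¹ : ℝ) : 𝕜) • piece c k j)) := by
  have hPB := hE.1.1 m P hP
  have hPe := hE.2 m P hP
  have hpos : ∀ j, 0 < P.1 (piece c k j) := fun j =>
    lt_of_le_of_ne (apply_nonneg _ _) fun h => hne j (hPB.eq_zero_of _ h.symm)
  set d : Fin n → 𝕜 := fun j => (((P.1 (piece c k j))⁻¹ : ℝ) : 𝕜) with hd
  have hd0 : ∀ j, d j ≠ 0 := fun j => by
    simpa [hd] using (hpos j).ne'
  set a : Fin m → 𝕜 := ∑ l, d l • piece c k l with ha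
  have hpa : ∀ j, piece a k j = d j • piece c k j := piece_sum_smul_piece hk d fun _ => c
  have hone : ∀ j, P.1 (piece a k j) = 1 := fun j => by
    rw [hpa, map_smul_eq_mul, hd, RCLike.norm_ofReal, abs_of_pos (inv_pos.2 (hpos j)),
      inv_mul_cancel₀ (hpos j).ne']
  set R : Seminorm 𝕜 (Fin n → 𝕜) := P.1.comp (Fintype.linearCombination 𝕜 (piece a k)) with hR
  have hRa : ∀ b, R b = P.1 (∑ j, b j • piece a k j) := fun b => by
    rw [hR, Seminorm.comp_apply, Fintype.linearCombination_apply]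
  have htr : ∀ l ≤ n, ∀ b, R (trunc l b) ≤ cb * R b := fun l hl b => by
    have := hPB.trunc_fst (k ⟨l, Nat.lt_succ_of_le hl⟩)
      ((hk.monotone (Fin.le_last _)).trans hkm) (∑ j, b j • piece a k j)
    rw [trunc_sum_smul_piece hk] at this
    rwa [hRa, hRa]
  have hQ : MemB ca cb ((R, R) : SNPair 𝕜 n) := by
    refine ⟨fun b hb => ?_, fun j => ?_, htr, htr, fun b => ?_⟩
    · have h0 : ∑ j, b j • piece a k j = 0 := hPB.eq_zero_of _ ((hRa b).symm.trans hb)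
      ext j
      have h1 := piece_sum_smul_piece hk b (fun _ => a) j
      rw [h0] at h1
      have h2 : piece (0 : Fin m → 𝕜) k j = 0 := by ext; simp [piece]
      rw [h2, hpa, smul_smul] at h1
      simpa [hd0 j, hne j] using h1.symm
    · change R _ = 1
      rw [hRa, Finset.sum_eq_single j]
      · simpa using hone j
      · intro l _ hl
        simp [hl]
      · simp
    · change R b ≤ ca * R b
      rw [hRa]
      conv_lhs => rw [hPe]
      exact hPB.snd_le _
  refine ⟨(R, R), hE.1.2.2 m n P hP _ hQ ⟨a, k, hk0, hk, hkm, hone, hRa, fun b => ?_⟩,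
    fun b => ?_⟩
  · exact hPe ▸ hRa b
  · simp only [hRa, hpa, hd]

end Blocks

section DualFamily

variable {ca cb : ℝ} {n m : ℕ} {E : Fam 𝕜}

lemma MemB.one_le_const {P : SNPair 𝕜 n} (hP : MemB ca cb P) (h : P.1 = P.2) (hn : 1 ≤ n) :
    1 ≤ ca := by
  have := hP.snd_le (Pi.single ⟨0, hn⟩ 1)
  rwa [← h, hP.single_eq_one, mul_one] at this

lemma MemB.norm_apply_le_dualNorm {P : SNPair 𝕜 n} (hP : MemB ca cb P) (f : Fin n → 𝕜)
    (i : Fin n) : ‖f i‖ ≤ dualNorm P.1 f := by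
  have := hP.norm_sum_mul_le_dualNorm f (Pi.single i 1)
  simpa [hP.single_eq_one, Pi.single_apply] using this

lemma MemB.one_le_dualNorm_single {P : SNPair 𝕜 n} (hP : MemB ca cb P) (i : Fin n) :
    1 ≤ dualNorm P.1 (Pi.single i 1) := by
  simpa using hP.norm_apply_le_dualNorm (Pi.single i 1) i

lemma MemB.dualNorm_single_le {P : SNPair 𝕜 n} (hP : MemB ca cb P) (hcb : 0 ≤ cb) (i : Fin n) :
    dualNorm P.1 (Pi.single i 1) ≤ 2 * cb := by
  refine hP.dualNorm_le (fun x => ?_) (by positivity)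
  simpa [Pi.single_apply] using hP.norm_apply_le x i

lemma MemB.dualNorm_trunc_le {P : SNPair 𝕜 n} (hP : MemB ca cb P) (hcb : 0 ≤ cb) {l : ℕ}
    (hl : l ≤ n) (f : Fin n → 𝕜) : dualNorm P.1 (trunc l f) ≤ cb * dualNorm P.1 f := by
  refine hP.dualNorm_le (fun x => ?_) (mul_nonneg hcb (hP.dualNorm_nonneg f))
  have h : ∑ i, trunc l f i * x i = ∑ i, f i * trunc l x i := by
    refine Finset.sum_congr rfl fun i _ => ?_
    simp only [trunc]
    split_ifs <;> simp
  rw [h]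
  calc _ ≤ dualNorm P.1 f * P.1 (trunc l x) := hP.norm_sum_mul_le_dualNorm f _
    _ ≤ dualNorm P.1 f * (cb * P.1 x) :=
      mul_le_mul_of_nonneg_left (hP.trunc_fst l hl x) (hP.dualNorm_nonneg f)
    _ = _ := by ring

/-- The normalized biorthogonal sequence of a member of `E` belongs to the dual family. -/
lemma IdentityBlockFam.exists_mem_dualFam (hE : IdentityBlockFam ca cb E) (hcb : 0 ≤ cb)
    (hn : 1 ≤ n) {P : SNPair 𝕜 n} (hP : P ∈ E n) :
    ∃ Q ∈ dualFam ca cb E n, ∀ f : Fin n → 𝕜,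
      Q.1 (fun i => f i * (dualNorm P.1 (Pi.single i 1) : 𝕜)) = dualNorm P.1 f := by
  have hPB := hE.1.1 n P hP
  set D : Fin n → ℝ := fun i => dualNorm P.1 (Pi.single i 1) with hD
  have hDpos : ∀ i, 0 < D i := fun i => zero_lt_one.trans_le (hPB.one_le_dualNorm_single i)
  have hD0 : ∀ i, (D i : 𝕜) ≠ 0 := fun i => RCLike.ofReal_ne_zero.2 (hDpos i).ne'
  have hpiece : ∀ j, piece (1 : Fin n → 𝕜) (fun i : Fin (n + 1) => (i : ℕ)) j = Pi.single j 1 :=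
    piece_val 1
  set R : Seminorm 𝕜 (Fin n → 𝕜) := (dualSeminorm hPB).comp
    (Fintype.linearCombination 𝕜 fun j => (D j)⁻¹ • (Pi.single j 1 : Fin n → 𝕜)) with hR
  have hRa : ∀ b, R b = dualNorm P.1 (∑ j, b j • ((D j)⁻¹ • (Pi.single j 1 : Fin n → 𝕜))) :=
    fun b => by
      rw [hR, Seminorm.comp_apply, Fintype.linearCombination_apply, dualSeminorm_apply]
  have hcoord : ∀ b : Fin n → 𝕜, ∑ j, b j • ((D j)⁻¹ • (Pi.single j 1 : Fin n → 𝕜))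
      = fun i => b i * (D i : 𝕜)⁻¹ := fun b => by
    ext i
    simp [Finset.sum_apply, Pi.single_apply, RCLike.real_smul_eq_coe_mul]
  have hRb : ∀ b, R b = dualNorm P.1 (fun i => b i * (D i : 𝕜)⁻¹) := fun b => by
    rw [hRa, hcoord]
  have htr : ∀ l ≤ n, ∀ b, R (trunc l b) ≤ cb * R b := fun l hl b => by
    rw [hRb, hRb]
    refine le_trans (le_of_eq (congrArg _ ?_)) (hPB.dualNorm_trunc_le hcb hl _)
    ext i
    simp only [trunc]
    split_ifs <;> simp
  have hQ : MemB ca cb ((R, R) : SNPair 𝕜 n) := by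
    refine ⟨fun b hb => ?_, fun j => ?_, htr, htr, fun b => ?_⟩
    · ext i
      have h1 := hPB.norm_apply_le_dualNorm (fun i => b i * (D i : 𝕜)⁻¹) i
      rw [← hRb, show R b = 0 from hb] at h1
      exact (mul_eq_zero_iff_right (inv_ne_zero (hD0 i))).1 (norm_le_zero_iff.1 h1)
    · have h1 : (fun i => (Pi.single j 1 : Fin n → 𝕜) i * (D i : 𝕜)⁻¹)
          = (D j : 𝕜)⁻¹ • (Pi.single j 1 : Fin n → 𝕜) := by
        ext i
        rcases eq_or_ne i j with rfl | h <;> simp [*]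
      change R _ = 1
      rw [hRb, h1, ← dualSeminorm_apply hPB, map_smul_eq_mul, dualSeminorm_apply, norm_inv,
        RCLike.norm_ofReal, abs_of_pos (hDpos j), inv_mul_cancel₀ (hDpos j).ne']
    · exact le_mul_of_one_le_left (apply_nonneg R b) (hPB.one_le_const (hE.2 n P hP) hn)
  refine ⟨(R, R), ⟨hQ, fun ε hε => ⟨(R, R), ⟨n, P, hP, 1, fun i => (i : ℕ), rfl,
    Fin.val_strictMono, by simp, fun j => ?_, rfl, fun b => ?_⟩, hQ, ?_⟩⟩, fun f => ?_⟩
  · rw [hpiece]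
    exact hDpos j
  · simp only [hpiece]
    exact hRa b
  · have : dB ((R, R) : SNPair 𝕜 n) (R, R) ≤ 0 :=
      Real.sSup_le (by rintro _ ⟨a, -, rfl⟩; simp) le_rfl
    linarith
  · change R _ = _
    rw [hRb]
    congr 1
    ext i
    rw [mul_assoc, mul_inv_cancel₀ (hD0 i), mul_one]

lemma abs_sub_le_dB (P Q : SNPair 𝕜 n) {x : Fin n → 𝕜} (hx : ∀ i, ‖x i‖ ≤ 1) :
    |P.1 x - Q.1 x| ≤ dB P Q ∧ |P.2 x - Q.2 x| ≤ dB P Q := by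
  have hle : ∀ (r : Seminorm 𝕜 (Fin n → 𝕜)) (y : Fin n → 𝕜), (∀ i, ‖y i‖ ≤ 1) →
      r y ≤ ∑ i, r (Pi.single i 1) := fun r y hy =>
    (seminorm_le_sum r y).trans (Finset.sum_le_sum fun i _ =>
      mul_le_of_le_one_left (apply_nonneg r _) (hy i))
  have hd : ∀ (r s : Seminorm 𝕜 (Fin n → 𝕜)) (y : Fin n → 𝕜), (∀ i, ‖y i‖ ≤ 1) →
      |r y - s y| ≤ ∑ i, r (Pi.single i 1) + ∑ i, s (Pi.single i 1) := fun r s y hy => by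
    rw [abs_le]
    constructor <;> linarith [hle r y hy, hle s y hy, apply_nonneg r y, apply_nonneg s y]
  have hbdd : BddAbove {t : ℝ | ∃ a : Fin n → 𝕜, (∀ i, ‖a i‖ ≤ 1) ∧
      t = max |P.1 a - Q.1 a| |P.2 a - Q.2 a|} := by
    refine ⟨max (∑ i, P.1 (Pi.single i 1) + ∑ i, Q.1 (Pi.single i 1))
      (∑ i, P.2 (Pi.single i 1) + ∑ i, Q.2 (Pi.single i 1)), ?_⟩
    rintro _ ⟨y, hy, rfl⟩
    exact max_le_max (hd _ _ y hy) (hd _ _ y hy)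
  have h := le_csSup hbdd ⟨x, hx, rfl⟩
  exact ⟨(le_max_left _ _).trans h, (le_max_right _ _).trans h⟩

/-- Members of the dual family are pointwise limits of normalized blocks of biorthogonal
sequences. -/
lemma exists_memDualBlocks_near {P : SNPair 𝕜 n} (hP : P ∈ dualFam ca cb E n) (x : Fin n → 𝕜)
    {ε : ℝ} (hε : 0 < ε) :
    ∃ Q : SNPair 𝕜 n, MemDualBlocks E Q ∧ |P.1 x - Q.1 x| < ε ∧ |P.2 x - Q.2 x| < ε := by
  set t : ℝ := ‖x‖ + 1 with ht
  have ht0 : 0 < t := by positivity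
  obtain ⟨Q, hQ, -, hd⟩ := hP.2 (ε / t) (by positivity)
  refine ⟨Q, hQ, ?_⟩
  have hx : ∀ i, ‖(((t⁻¹ : ℝ) : 𝕜) • x) i‖ ≤ 1 := fun i => by
    rw [Pi.smul_apply, smul_eq_mul, norm_mul, RCLike.norm_ofReal, abs_of_pos (by positivity),
      inv_mul_le_iff₀ ht0, mul_one]
    linarith [norm_le_pi_norm x i]
  obtain ⟨h1, h2⟩ := abs_sub_le_dB P Q hx
  have key : ∀ r s : Seminorm 𝕜 (Fin n → 𝕜),
      |r (((t⁻¹ : ℝ) : 𝕜) • x) - s (((t⁻¹ : ℝ) : 𝕜) • x)| ≤ dB P Q → |r x - s x| < ε := by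
    intro r s h
    rw [map_smul_eq_mul, map_smul_eq_mul, ← mul_sub, abs_mul, RCLike.norm_ofReal, abs_abs,
      abs_of_pos (inv_pos.2 ht0), inv_mul_le_iff₀ ht0] at h
    calc _ ≤ t * dB P Q := h
      _ < t * (ε / t) := mul_lt_mul_of_pos_left hd ht0
      _ = ε := by field_simp
  exact ⟨key _ _ h1, key _ _ h2⟩

lemma fst_eq_snd_of_mem_dualFam {P : SNPair 𝕜 n} (hP : P ∈ dualFam ca cb E n) : P.1 = P.2 := by
  ext x
  refine eq_of_forall_dist_le fun ε hε => ?_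
  obtain ⟨Q, ⟨-, -, -, -, -, -, -, -, -, hQ, -⟩, h1, h2⟩ :=
    exists_memDualBlocks_near hP x (half_pos hε)
  rw [← hQ] at h2
  rw [abs_lt] at h1 h2
  rw [Real.dist_eq, abs_le]
  constructor <;> linarith

end DualFamily

section Duality

variable {ca cb : ℝ} {n : ℕ} {E : Fam 𝕜} {p q : ℝ≥0∞}

lemma IdentityBlockFam.le_lpnorm_of_dual (hE : IdentityBlockFam ca cb E) (hcb : 0 ≤ cb)
    (hpq : p.HolderConjugate q) (hn : 1 ≤ n) {C : ℝ} (hC : 0 ≤ C)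
    (h : ∀ Q ∈ dualFam ca cb E n, ∀ a, lpnorm q a ≤ C * Q.1 a) {P : SNPair 𝕜 n} (hP : P ∈ E n)
    (a : Fin n → 𝕜) : P.1 a ≤ C * lpnorm p a := by
  have hPB := hE.1.1 n P hP
  obtain ⟨Q, hQ, hQf⟩ := hE.exists_mem_dualFam hcb hn hP
  obtain ⟨f, hf, hfa⟩ := hPB.exists_norming a
  have h1 : lpnorm q f ≤ 1 * lpnorm q fun i => f i * (dualNorm P.1 (Pi.single i 1) : 𝕜) := by
    refine lpnorm_le_mul (ENNReal.HolderConjugate.one_le q p) zero_le_one fun i => ?_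
    rw [one_mul, norm_mul, RCLike.norm_ofReal]
    exact le_mul_of_one_le_right (norm_nonneg _)
      ((hPB.one_le_dualNorm_single i).trans (le_abs_self _))
  have h2 := h Q hQ fun i => f i * (dualNorm P.1 (Pi.single i 1) : 𝕜)
  rw [hQf] at h2
  have h3 : lpnorm q f ≤ C := by nlinarith
  calc P.1 a = ‖∑ i, f i * a i‖ := by
        rw [hfa, RCLike.norm_ofReal, abs_of_nonneg (apply_nonneg _ _)]
    _ ≤ lpnorm q f * lpnorm p a := norm_sum_mul_le hpq.symm f a
    _ ≤ C * lpnorm p a := mul_le_mul_of_nonneg_right h3 (lpnorm_nonneg p a)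

lemma IdentityBlockFam.lpnorm_le_of_dual (hE : IdentityBlockFam ca cb E) (hcb : 0 ≤ cb)
    (hpq : p.HolderConjugate q) (hn : 1 ≤ n) {T : ℝ} (hT : 0 ≤ T)
    (h : ∀ Q ∈ dualFam ca cb E n, ∀ a, Q.1 a ≤ T * lpnorm p a) {P : SNPair 𝕜 n} (hP : P ∈ E n)
    (a : Fin n → 𝕜) : lpnorm q a ≤ 2 * cb * T * P.1 a := by
  have hPB := hE.1.1 n P hP
  obtain ⟨Q, hQ, hQf⟩ := hE.exists_mem_dualFam hcb hn hP
  have hPa := apply_nonneg P.1 a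
  refine lpnorm_le_of_forall_norm_sum_le hpq (by positivity) a fun f => ?_
  have h1 : lpnorm p (fun i => f i * (dualNorm P.1 (Pi.single i 1) : 𝕜))
      ≤ 2 * cb * lpnorm p f := by
    refine lpnorm_le_mul (ENNReal.HolderConjugate.one_le p q) (by positivity) fun i => ?_
    rw [norm_mul, RCLike.norm_ofReal, abs_of_nonneg (hPB.dualNorm_nonneg _), mul_comm]
    exact mul_le_mul_of_nonneg_right (hPB.dualNorm_single_le hcb i) (norm_nonneg _)
  have h2 := h Q hQ fun i => f i * (dualNorm P.1 (Pi.single i 1) : 𝕜)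
  rw [hQf] at h2
  calc ‖∑ i, f i * a i‖ ≤ dualNorm P.1 f * P.1 a := hPB.norm_sum_mul_le_dualNorm f a
    _ ≤ (T * (2 * cb * lpnorm p f)) * P.1 a :=
      mul_le_mul_of_nonneg_right (h2.trans (mul_le_mul_of_nonneg_left h1 hT)) hPa
    _ = _ := by ring

lemma sum_normalized_piece_apply {m : ℕ} (D : Fin n → ℝ) (b : Fin n → 𝕜) (c : Fin m → 𝕜)
    (k : Fin (n + 1) → ℕ) (x : Fin m → 𝕜) :
    ∑ i, (∑ j, b j • ((D j)⁻¹ • piece c k j)) i * x i =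
      ∑ j, b j * ((D j : 𝕜)⁻¹ * ∑ i, piece c k j i * x i) := by
  simp only [Finset.sum_apply, Finset.sum_mul, Pi.smul_apply, smul_eq_mul, Finset.mul_sum,
    RCLike.real_smul_eq_coe_mul, RCLike.ofReal_inv]
  rw [Finset.sum_comm]
  exact Finset.sum_congr rfl fun j _ => Finset.sum_congr rfl fun i _ => by ring

lemma IdentityBlockFam.lpnorm_le_of_memDualBlocks (hE : IdentityBlockFam ca cb E) (hcb : 0 ≤ cb)
    (hpq : p.HolderConjugate q) {T : ℝ} (hT : 0 ≤ T)
    (h : ∀ P ∈ E n, ∀ a, P.1 a ≤ T * lpnorm p a) {Q : SNPair 𝕜 n} (hQ : MemDualBlocks E Q)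
    (b : Fin n → 𝕜) : lpnorm q b ≤ 2 * cb * T * Q.1 b := by
  obtain ⟨m, P, hP, c, k, hk0, hk, hkm, hD, -, hQb⟩ := hQ
  have hPB := hE.1.1 m P hP
  set D : Fin n → ℝ := fun j => dualNorm P.1 (piece c k j) with hDdef
  have hD0 : ∀ j, (D j : 𝕜) ≠ 0 := fun j => RCLike.ofReal_ne_zero.2 (hD j).ne'
  have hw : ∀ j, ∃ w : Fin m → 𝕜, P.1 w ≤ 1 ∧ ∑ i, piece c k j i * w i = D j := fun j => by
    obtain ⟨x, hx, hxD, -⟩ := hPB.exists_dualNorm_eq (piece c k j)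
    obtain ⟨u, hu, hux⟩ := exists_norm_eq_one_mul_eq (∑ i, piece c k j i * x i)
    refine ⟨u • x, by rwa [map_smul_eq_mul, hu, one_mul], ?_⟩
    rw [hxD] at hux
    rw [← hux, Finset.mul_sum]
    exact Finset.sum_congr rfl fun i _ => by simp only [Pi.smul_apply, smul_eq_mul]; ring
  choose w hw1 hwD using hw
  set v : Fin m → 𝕜 := ∑ l, piece (w l) k l with hv
  have hpv : ∀ j, piece v k j = piece (w j) k j := piece_sum_piece hk w
  have hpair : ∀ j, ∑ i, piece c k j i * piece v k j i = D j := fun j => by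
    rw [hpv, sum_piece_mul_piece_self, hwD]
  have hne : ∀ j, piece v k j ≠ 0 := fun j h0 => hD0 j (by simp [← hpair j, h0])
  have hpos : ∀ j, 0 < P.1 (piece v k j) := fun j =>
    lt_of_le_of_ne (apply_nonneg _ _) fun h => hne j (hPB.eq_zero_of _ h.symm)
  have hle : ∀ j, P.1 (piece v k j) ≤ 2 * cb := fun j => by
    rw [hpv]
    exact (hPB.map_piece_le (w j) hk hkm j).trans (mul_le_of_le_one_right (by positivity) (hw1 j))
  obtain ⟨R, hR, hRa⟩ := hE.exists_block hP v hk0 hk hkm hne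
  refine lpnorm_le_of_forall_norm_sum_le hpq
    (mul_nonneg (by positivity) (apply_nonneg _ _)) b fun a => ?_
  set y : Fin m → 𝕜 := ∑ j, a j • piece v k j with hy
  have hsum : ∑ i, a i * b i = ∑ i, (∑ j, b j • ((D j)⁻¹ • piece c k j)) i * y i := by
    rw [sum_normalized_piece_apply]
    refine Finset.sum_congr rfl fun j _ => ?_
    have h1 : ∑ i, piece c k j i * y i = a j * D j := by
      rw [← sum_piece_mul_piece_self (k := k) c y j, hy, piece_sum_smul_piece hk a fun _ => v,
        ← hpair, Finset.mul_sum]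
      exact Finset.sum_congr rfl fun i _ => by simp only [Pi.smul_apply, smul_eq_mul]; ring
    rw [h1, mul_comm (a j) (D j : 𝕜), inv_mul_cancel_left₀ (hD0 j), mul_comm]
  have hRy : R.1 (fun j => a j * (P.1 (piece v k j) : 𝕜)) = P.1 y := by
    rw [hRa, hy]
    refine congrArg _ (Finset.sum_congr rfl fun j _ => ?_)
    rw [smul_smul, mul_assoc, ← RCLike.ofReal_mul, mul_inv_cancel₀ (hpos j).ne',
      RCLike.ofReal_one, mul_one]
  have hy1 : P.1 y ≤ T * (2 * cb * lpnorm p a) := by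
    rw [← hRy]
    refine (h R hR _).trans (mul_le_mul_of_nonneg_left ?_ hT)
    refine lpnorm_le_mul (ENNReal.HolderConjugate.one_le p q) (by positivity) fun j => ?_
    rw [norm_mul, RCLike.norm_ofReal, abs_of_pos (hpos j), mul_comm]
    exact mul_le_mul_of_nonneg_right (hle j) (norm_nonneg _)
  calc ‖∑ i, a i * b i‖ ≤ Q.1 b * P.1 y := by
        rw [hsum, hQb]
        exact hPB.norm_sum_mul_le_dualNorm _ y
    _ ≤ Q.1 b * (T * (2 * cb * lpnorm p a)) := mul_le_mul_of_nonneg_left hy1 (apply_nonneg _ _)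
    _ = _ := by ring

/-- The last cut point of a partition into intervals may be moved to the end. -/
lemma exists_extended_cuts {m : ℕ} (hn : 1 ≤ n) {k : Fin (n + 1) → ℕ} (hk0 : k 0 = 0)
    (hk : StrictMono k) (hkm : k (Fin.last n) ≤ m) :
    ∃ k' : Fin (n + 1) → ℕ, k' 0 = 0 ∧ StrictMono k' ∧ k' (Fin.last n) = m ∧
      ∀ (c x : Fin m → 𝕜) (j : Fin n),
        ∑ i, piece c k j i * x i = ∑ i, piece c k j i * piece x k' j i := by
  have hne : ∀ j : Fin n, j.castSucc ≠ Fin.last n := fun j => (Fin.castSucc_lt_last j).ne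
  refine ⟨Function.update k (Fin.last n) m, ?_, ?_, by simp, fun c x j => ?_⟩
  · rw [Function.update_of_ne, hk0]
    exact fun h => by simp [Fin.ext_iff] at h; omega
  · refine Fin.strictMono_iff_lt_succ.2 fun j => ?_
    rw [Function.update_of_ne (hne j)]
    have := hk j.castSucc_lt_succ
    rcases eq_or_ne j.succ (Fin.last n) with h | h
    · rw [h, Function.update_self]
      rw [h] at this
      omega
    · rwa [Function.update_of_ne h]
  · refine Finset.sum_congr rfl fun i _ => ?_
    by_cases h : k j.castSucc ≤ (i : ℕ) ∧ (i : ℕ) < k j.succ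
    · rw [piece_apply_of_mem (c := x)]
      rw [Function.update_of_ne (hne j)]
      refine ⟨h.1, ?_⟩
      rcases eq_or_ne j.succ (Fin.last n) with h' | h'
      · rw [h', Function.update_self]
        exact i.2
      · rw [Function.update_of_ne h']
        exact h.2
    · rw [piece_apply_of_notMem h, zero_mul, zero_mul]

lemma IdentityBlockFam.le_lpnorm_of_memDualBlocks (hE : IdentityBlockFam ca cb E)
    (hpq : p.HolderConjugate q) (hn : 1 ≤ n) {C : ℝ} (hC : 0 ≤ C)
    (h : ∀ P ∈ E n, ∀ a, lpnorm q a ≤ C * P.1 a) {Q : SNPair 𝕜 n} (hQ : MemDualBlocks E Q)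
    (b : Fin n → 𝕜) : Q.1 b ≤ C * lpnorm p b := by
  obtain ⟨m, P, hP, c, k, hk0, hk, hkm, hD, -, hQb⟩ := hQ
  have hPB := hE.1.1 m P hP
  set D : Fin n → ℝ := fun j => dualNorm P.1 (piece c k j) with hDdef
  obtain ⟨x, hx, hxe, -⟩ := hPB.exists_dualNorm_eq (∑ j, b j • ((D j)⁻¹ • piece c k j))
  obtain ⟨k', hk0', hk', hkm', hext⟩ := exists_extended_cuts (𝕜 := 𝕜) hn hk0 hk hkm
  classical
  set w : Fin n → Fin m → 𝕜 := fun j => if piece x k' j = 0 then 1 else x with hw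
  set v : Fin m → 𝕜 := ∑ l, piece (w l) k' l with hv
  have hpv : ∀ j, piece v k' j = piece (w j) k' j := piece_sum_piece hk' w
  have hne : ∀ j, piece v k' j ≠ 0 := fun j => by
    rw [hpv, hw]
    dsimp only
    split_ifs with h0
    · intro h1
      have hlt : k' j.castSucc < k' j.succ := hk' j.castSucc_lt_succ
      have hm : k' j.succ ≤ m := hkm' ▸ hk'.monotone (Fin.le_last _)
      have h2 := congrFun h1 ⟨k' j.castSucc, hlt.trans_le hm⟩
      rw [piece_apply_of_mem (k := k') (j := j) ⟨le_rfl, hlt⟩] at h2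
      simp at h2
    · exact h0
  obtain ⟨R, hR, hRa⟩ := hE.exists_block hP v hk0' hk' hkm'.le hne
  set a : Fin n → 𝕜 := fun j => (P.1 (piece x k' j) : 𝕜) with ha
  have hRx : R.1 a = P.1 x := by
    rw [hRa]
    conv_rhs => rw [← sum_piece hk' hk0' hkm' x]
    refine congrArg _ (Finset.sum_congr rfl fun j _ => ?_)
    by_cases h0 : piece x k' j = 0
    · simp [ha, h0]
    · have h1 : P.1 (piece x k' j) ≠ 0 := fun h1 => h0 (hPB.eq_zero_of _ h1)
      rw [hpv, hw]
      simp only [if_neg h0, ha]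
      rw [smul_smul, ← RCLike.ofReal_mul, mul_inv_cancel₀ h1, RCLike.ofReal_one, one_smul]
  have hq : lpnorm q a ≤ C := (h R hR a).trans (by
    rw [hRx]
    exact mul_le_of_le_one_right hC hx)
  calc Q.1 b = ‖∑ j, b j * ((D j : 𝕜)⁻¹ * ∑ i, piece c k j i * x i)‖ := by
        rw [← sum_normalized_piece_apply, hxe, hQb]
    _ ≤ ∑ j, ‖b j‖ * ‖a j‖ := by
        refine (norm_sum_le _ _).trans (Finset.sum_le_sum fun j _ => ?_)
        rw [norm_mul]
        refine mul_le_mul_of_nonneg_left ?_ (norm_nonneg _)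
        rw [norm_mul, norm_inv, RCLike.norm_ofReal, abs_of_pos (hD j), inv_mul_le_iff₀ (hD j),
          hext, ha, RCLike.norm_ofReal, abs_of_nonneg (apply_nonneg _ _)]
        exact hPB.norm_sum_mul_le_dualNorm _ _
    _ ≤ lpnorm p b * lpnorm q a := sum_norm_mul_le hpq b a
    _ ≤ lpnorm p b * C := mul_le_mul_of_nonneg_left hq (lpnorm_nonneg p b)
    _ = C * lpnorm p b := mul_comm _ _

lemma IdentityBlockFam.lpnorm_le_of_mem_dualFam (hE : IdentityBlockFam ca cb E) (hcb : 0 ≤ cb)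
    (hpq : p.HolderConjugate q) {T : ℝ} (hT : 0 ≤ T)
    (h : ∀ P ∈ E n, ∀ a, P.1 a ≤ T * lpnorm p a) {Q : SNPair 𝕜 n} (hQ : Q ∈ dualFam ca cb E n)
    (b : Fin n → 𝕜) : lpnorm q b ≤ 2 * cb * T * Q.1 b := by
  refine le_of_forall_pos_le_add fun ε hε => ?_
  obtain ⟨Q', hQ', hd, -⟩ := exists_memDualBlocks_near hQ b
    (show 0 < ε / (2 * cb * T + 1) by positivity)
  have h1 := hE.lpnorm_le_of_memDualBlocks hcb hpq hT h hQ' b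
  have h2 : Q'.1 b ≤ Q.1 b + ε / (2 * cb * T + 1) := by linarith [(abs_lt.1 hd).1]
  have h3 : 2 * cb * T * (ε / (2 * cb * T + 1)) ≤ ε := by
    rw [← mul_div_assoc, div_le_iff₀ (by positivity)]
    nlinarith
  nlinarith [mul_le_mul_of_nonneg_left h2 (show 0 ≤ 2 * cb * T by positivity)]

lemma IdentityBlockFam.le_lpnorm_of_mem_dualFam (hE : IdentityBlockFam ca cb E)
    (hpq : p.HolderConjugate q) (hn : 1 ≤ n) {C : ℝ} (hC : 0 ≤ C)
    (h : ∀ P ∈ E n, ∀ a, lpnorm q a ≤ C * P.1 a) {Q : SNPair 𝕜 n} (hQ : Q ∈ dualFam ca cb E n)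
    (b : Fin n → 𝕜) : Q.1 b ≤ C * lpnorm p b := by
  refine le_of_forall_pos_le_add fun ε hε => ?_
  obtain ⟨Q', hQ', hd, -⟩ := exists_memDualBlocks_near hQ b hε
  linarith [hE.le_lpnorm_of_memDualBlocks hpq hn hC h hQ' b, (abs_lt.1 hd).2]

end Duality

section Constants

variable {ca cb : ℝ} {n : ℕ} {F G : Fam 𝕜} {p q : ℝ≥0∞}

/-- The set of admissible constants in the definition of `alphaC`. -/
def alphaSet (p : ℝ≥0∞) (F : Fam 𝕜) (n : ℕ) : Set ℝ :=
  {T : ℝ | 0 < T ∧ ∀ P ∈ F n, ∀ a : Fin n → 𝕜, P.1 a ≤ T * lpnorm p a}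

/-- The set of admissible constants in the definition of `betaC`. -/
def betaSet (q : ℝ≥0∞) (F : Fam 𝕜) (n : ℕ) : Set ℝ :=
  {C : ℝ | 0 < C ∧ ∀ P ∈ F n, ∀ a : Fin n → 𝕜, lpnorm q a ≤ C * P.1 a}

lemma alphaC_eq (hF : ∀ P ∈ F n, P.1 = P.2) : alphaC p F n = sInf (alphaSet p F n) := by
  refine congrArg sInf (Set.ext fun T => and_congr_right fun _ => ?_)
  exact forall₂_congr fun P hP => by rw [hF P hP]

lemma betaC_eq (hF : ∀ P ∈ F n, P.1 = P.2) (hB : ∀ P ∈ F n, MemB ca cb P) :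
    betaC q F n = sInf (betaSet q F n) := by
  refine congrArg sInf (Set.ext fun T => and_congr_right fun _ => ?_)
  exact forall₂_congr fun P hP => by
    simp only [← hF P hP, (hB P hP).single_eq_one, RCLike.ofReal_one, mul_one]

lemma alphaSet_nonempty (hp : 1 ≤ p) (hn : 1 ≤ n) (hB : ∀ P ∈ F n, MemB ca cb P) :
    (alphaSet p F n).Nonempty := by
  refine ⟨n, by exact_mod_cast hn, fun P hP a => ((hB P hP).le_sum a).trans ?_⟩
  simpa using Finset.sum_le_card_nsmul Finset.univ (fun i => ‖a i‖) (lpnorm p a)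
    fun i _ => norm_le_lpnorm hp a i

lemma sInf_alphaSet_betaSet {K : ℝ} (hK : 0 < K) (hne : (alphaSet p F n).Nonempty)
    (h1 : betaSet q G n ⊆ alphaSet p F n) (h2 : ∀ T ∈ alphaSet p F n, K * T ∈ betaSet q G n) :
    sInf (alphaSet p F n) ≤ sInf (betaSet q G n) ∧
      sInf (betaSet q G n) ≤ K * sInf (alphaSet p F n) := by
  obtain ⟨T₀, hT₀⟩ := hne
  refine ⟨csInf_le_csInf ⟨0, fun T hT => hT.1.le⟩ ⟨_, h2 T₀ hT₀⟩ h1, ?_⟩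
  rw [← inv_mul_le_iff₀ hK]
  refine le_csInf ⟨T₀, hT₀⟩ fun T hT => ?_
  rw [inv_mul_le_iff₀ hK]
  exact csInf_le ⟨0, fun T hT => hT.1.le⟩ (h2 T hT)

end Constants

/-- duality lemma: for an identity block `E ⊆ ⋃_{n≥1} B_n^{a,b}`,
`1 ≤ p ≤ ∞` with conjugate exponent `q` and every `n ≥ 1`,
`α_{p,n}(E) ≤ β_{q,n}(E^*) ≤ 2b·α_{p,n}(E)` and
`α_{p,n}(E^*) ≤ β_{q,n}(E) ≤ 2b·α_{p,n}(E^*)`. -/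
theorem duality_alpha_beta (ca cb : ℝ) (hca : 0 ≤ ca) (hcb : 1 ≤ cb)
    (E : Fam 𝕜) (hE : IdentityBlockFam ca cb E)
    (p q : ℝ≥0∞) (hp : 1 ≤ p) (hpq : 1 / p + 1 / q = 1) (n : ℕ) (hn : 1 ≤ n) :
    (alphaC p E n ≤ betaC q (dualFam ca cb E) n ∧
      betaC q (dualFam ca cb E) n ≤ 2 * cb * alphaC p E n) ∧
    (alphaC p (dualFam ca cb E) n ≤ betaC q E n ∧
      betaC q E n ≤ 2 * cb * alphaC p (dualFam ca cb E) n) := by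
  have hcb0 : 0 < cb := zero_lt_one.trans_le hcb
  have hpq' : p.HolderConjugate q := ⟨by simpa using hpq⟩
  have hEB : ∀ P ∈ E n, MemB ca cb P := hE.1.1 n
  have hDB : ∀ P ∈ dualFam ca cb E n, MemB ca cb P := fun P hP => hP.1
  have hDe : ∀ P ∈ dualFam ca cb E n, P.1 = P.2 := fun P hP => fst_eq_snd_of_mem_dualFam hP
  rw [alphaC_eq (hE.2 n), betaC_eq (hE.2 n) hEB, alphaC_eq hDe, betaC_eq hDe hDB]
  have hpos : ∀ T : ℝ, 0 < T → 0 < 2 * cb * T := fun T hT => by positivity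
  exact ⟨sInf_alphaSet_betaSet (by positivity) (alphaSet_nonempty hp hn hEB)
      (fun C hC => ⟨hC.1, fun P hP => hE.le_lpnorm_of_dual hcb0.le hpq' hn hC.1.le hC.2 hP⟩)
      (fun T hT => ⟨hpos T hT.1, fun Q hQ =>
        hE.lpnorm_le_of_mem_dualFam hcb0.le hpq' hT.1.le hT.2 hQ⟩),
    sInf_alphaSet_betaSet (by positivity) (alphaSet_nonempty hp hn hDB)
      (fun C hC => ⟨hC.1, fun Q hQ => hE.le_lpnorm_of_mem_dualFam hpq' hn hC.1.le hC.2 hQ⟩)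
      (fun T hT => ⟨hpos T hT.1, fun P hP =>
        hE.lpnorm_le_of_dual hcb0.le hpq' hn hT.1.le hT.2 hP⟩)⟩

end AsymSeminorms
end
end

section
/- Let a ≥ 0, b ≥ 1 and let E ⊆ ⋃_{n≥1} B_n^{a,b} be an identity block. If N > 1 is an integer and 1 ≤ p ≤ r < ∞ are such that α_{r,N}(E) ≤ N^{1/p − 1/r}, then for every 1 ≤ s < p one has sup_n α_{s,n}(E) < ∞ (that is, E has block basic type s). -/
open scoped BigOperators ENNReal

noncomputable section

namespace AsymSeminorms

section Blocks

variable {𝕜 : Type*} [RCLike 𝕜]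

theorem MemB.le_sum_norm {ca cb : ℝ} {n : ℕ} {P : SNPair 𝕜 n} (hP : MemB ca cb P)
    (x : Fin n → 𝕜) : P.1 x ≤ ∑ i, ‖x i‖ := by
  have hx : x = ∑ i, x i • (Pi.single i 1 : Fin n → 𝕜) := by
    ext j
    simp [Finset.sum_apply, Pi.single_apply]
  calc P.1 x = P.1 (∑ i, x i • (Pi.single i 1 : Fin n → 𝕜)) := by rw [← hx]
    _ ≤ ∑ i, P.1 (x i • (Pi.single i 1 : Fin n → 𝕜)) :=
        Finset.le_sum_of_subadditive _ (map_zero _).le (map_add_le_add _) _ _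
    _ = ∑ i, ‖x i‖ := by
        simp [map_smul_eq_mul, hP.single_eq_one]

theorem lpnorm_ofReal {s : ℝ} (hs : 0 ≤ s) {n : ℕ} (x : Fin n → 𝕜) :
    lpnorm (ENNReal.ofReal s) x = (∑ i, ‖x i‖ ^ s) ^ (1 / s) := by
  simp [lpnorm, ENNReal.toReal_ofReal hs]

theorem sum_rpow_nonneg {n : ℕ} (s : ℝ) (x : Fin n → 𝕜) : 0 ≤ ∑ i, ‖x i‖ ^ s :=
  Finset.sum_nonneg fun _ _ => Real.rpow_nonneg (norm_nonneg _) _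

theorem norm_le_lpnorm_s4 {s : ℝ} (hs : 0 < s) {n : ℕ} (x : Fin n → 𝕜) (i : Fin n) :
    ‖x i‖ ≤ lpnorm (ENNReal.ofReal s) x := by
  rw [lpnorm_ofReal hs.le, one_div, Real.le_rpow_inv_iff_of_pos (norm_nonneg _)
    (sum_rpow_nonneg s x) hs]
  exact Finset.single_le_sum (f := fun i => ‖x i‖ ^ s)
    (fun _ _ => Real.rpow_nonneg (norm_nonneg _) _) (Finset.mem_univ i)

theorem lpnorm_nonneg_s4 {s : ℝ} (hs : 0 ≤ s) {n : ℕ} (x : Fin n → 𝕜) :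
    0 ≤ lpnorm (ENNReal.ofReal s) x := by
  rw [lpnorm_ofReal hs]
  exact Real.rpow_nonneg (sum_rpow_nonneg s x) _

theorem lpnorm_le_of_norm_le {s : ℝ} (hs : 0 < s) {n : ℕ} {x : Fin n → 𝕜} {M : ℝ} (hM : 0 ≤ M)
    (hx : ∀ i, ‖x i‖ ≤ M) : lpnorm (ENNReal.ofReal s) x ≤ (n : ℝ) ^ (1 / s) * M := by
  rw [lpnorm_ofReal hs.le]
  calc (∑ i, ‖x i‖ ^ s) ^ (1 / s) ≤ ((n : ℝ) * M ^ s) ^ (1 / s) := by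
        refine Real.rpow_le_rpow (sum_rpow_nonneg s x) ?_ (by positivity)
        calc ∑ i, ‖x i‖ ^ s ≤ ∑ _i : Fin n, M ^ s :=
              Finset.sum_le_sum fun i _ => Real.rpow_le_rpow (norm_nonneg _) (hx i) hs.le
          _ = n * M ^ s := by simp
    _ = (n : ℝ) ^ (1 / s) * M := by
        rw [Real.mul_rpow (by positivity) (by positivity), ← Real.rpow_mul hM,
          mul_one_div_cancel hs.ne', Real.rpow_one]

/-- In an identity block the infimum defining `α_{s,n}` is attained. -/
theorem le_alphaC_mul_lpnorm {ca cb : ℝ} {E : Fam 𝕜} (hE : IdentityBlockFam ca cb E) {s : ℝ}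
    (hs : 0 < s) {n : ℕ} {P : SNPair 𝕜 n} (hP : P ∈ E n) (x : Fin n → 𝕜) :
    P.2 x ≤ alphaC (ENNReal.ofReal s) E n * lpnorm (ENNReal.ofReal s) x := by
  have hmem : ((n : ℝ) + 1) ∈ {T : ℝ | 0 < T ∧ ∀ P ∈ E n, ∀ a : Fin n → 𝕜,
      P.2 a ≤ T * lpnorm (ENNReal.ofReal s) a} := by
    refine ⟨by positivity, fun Q hQ y => ?_⟩
    rw [← hE.2 n Q hQ]
    calc Q.1 y ≤ ∑ i, ‖y i‖ := (hE.1.1 n Q hQ).le_sum_norm y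
      _ ≤ ∑ _i : Fin n, lpnorm (ENNReal.ofReal s) y :=
          Finset.sum_le_sum fun i _ => norm_le_lpnorm_s4 hs y i
      _ = n * lpnorm (ENNReal.ofReal s) y := by simp
      _ ≤ (n + 1) * lpnorm (ENNReal.ofReal s) y := by
          have := lpnorm_nonneg_s4 hs.le y
          linarith
  rcases (lpnorm_nonneg_s4 hs.le x).eq_or_lt with h0 | hpos
  · have := hmem.2 P hP x
    rw [← h0] at this ⊢
    simpa using this
  · rw [← div_le_iff₀ hpos]
    refine le_csInf ⟨_, hmem⟩ fun T hT => ?_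
    rw [div_le_iff₀ hpos]
    exact hT.2 P hP x

/-- The linear map sending `e_j` to the `j`-th block piece. -/
def blockMap {n m : ℕ} (a : Fin n → 𝕜) (k : Fin (m + 1) → ℕ) :
    (Fin m → 𝕜) →ₗ[𝕜] (Fin n → 𝕜) :=
  Fintype.linearCombination 𝕜 (piece a k)

theorem blockMap_apply {n m : ℕ} (a : Fin n → 𝕜) (k : Fin (m + 1) → ℕ) (b : Fin m → 𝕜) :
    blockMap a k b = ∑ j, b j • piece a k j := rfl

/-- The pair of seminorms induced by a pair on a block sequence. -/
def blockPair {n m : ℕ} (P : SNPair 𝕜 n) (a : Fin n → 𝕜) (k : Fin (m + 1) → ℕ) : SNPair 𝕜 m :=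
  (P.1.comp (blockMap a k), P.2.comp (blockMap a k))

theorem index_unique {m : ℕ} {k : Fin (m + 1) → ℕ} (hk : Monotone k) {i : ℕ} {j l : Fin m}
    (hj : k j.castSucc ≤ i ∧ i < k j.succ) (hl : k l.castSucc ≤ i ∧ i < k l.succ) : j = l := by
  rcases lt_trichotomy j l with h | h | h
  · have : k j.succ ≤ k l.castSucc := hk (Fin.succ_le_castSucc_iff.2 h)
    omega
  · exact h
  · have : k l.succ ≤ k j.castSucc := hk (Fin.succ_le_castSucc_iff.2 h)
    omega

theorem blockMap_apply_of_mem {n m : ℕ} (a : Fin n → 𝕜) {k : Fin (m + 1) → ℕ} (hk : Monotone k)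
    (b : Fin m → 𝕜) {i : Fin n} {j : Fin m} (hj : k j.castSucc ≤ (i : ℕ) ∧ (i : ℕ) < k j.succ) :
    blockMap a k b i = b j * a i := by
  rw [blockMap_apply, Finset.sum_apply, Finset.sum_eq_single j]
  · simp [piece, hj]
  · intro l _ hl
    have : ¬ (k l.castSucc ≤ (i : ℕ) ∧ (i : ℕ) < k l.succ) :=
      fun h => hl (index_unique hk h hj)
    simp [piece, this]
  · simp

theorem trunc_blockMap {n m : ℕ} (a : Fin n → 𝕜) {k : Fin (m + 1) → ℕ} (hk : Monotone k)
    (b : Fin m → 𝕜) (l : Fin (m + 1)) :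
    blockMap a k (trunc l b) = trunc (k l) (blockMap a k b) := by
  ext i
  simp only [blockMap_apply, trunc, Finset.sum_apply, Pi.smul_apply, smul_eq_mul, piece]
  split_ifs with hi
  · refine Finset.sum_congr rfl fun j _ => ?_
    by_cases hj : (j : ℕ) < l
    · simp [hj]
    · have : k l ≤ k j.castSucc := hk (by simp [Fin.le_def]; omega)
      have h' : ¬ (k j.castSucc ≤ (i : ℕ) ∧ (i : ℕ) < k j.succ) := by omega
      simp [h']
  · refine Finset.sum_eq_zero fun j _ => ?_
    by_cases hj : (j : ℕ) < l
    · have : k j.succ ≤ k l := hk (by simp [Fin.le_def]; omega)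
      have h' : ¬ (k j.castSucc ≤ (i : ℕ) ∧ (i : ℕ) < k j.succ) := by omega
      simp [h']
    · simp [hj]

theorem memB_blockPair {ca cb : ℝ} {n m : ℕ} {P : SNPair 𝕜 n} (hP : MemB ca cb P)
    {a : Fin n → 𝕜} {k : Fin (m + 1) → ℕ} (hk : Monotone k) (hkn : k (Fin.last m) ≤ n)
    (hone : ∀ j, P.1 (piece a k j) = 1) : MemB ca cb (blockPair P a k) where
  eq_zero_of x hx := by
    have h0 : blockMap a k x = 0 := hP.eq_zero_of _ hx
    ext j
    by_contra hxj
    have hp0 : piece a k j = 0 := by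
      ext i
      by_cases hi : k j.castSucc ≤ (i : ℕ) ∧ (i : ℕ) < k j.succ
      · have := blockMap_apply_of_mem a hk x hi
        rw [h0] at this
        have : a i = 0 := (mul_eq_zero.1 this.symm).resolve_left hxj
        simp [piece, this]
      · simp [piece, hi]
    have := hone j
    simp [hp0] at this
  single_eq_one j := by
    have : blockMap a k (Pi.single j 1) = piece a k j := by
      simp [blockMap, Fintype.linearCombination_apply_single]
    simp [blockPair, this, hone]
  trunc_fst l hl x := by
    have := trunc_blockMap a hk x ⟨l, by omega⟩
    simp only [blockPair, Seminorm.comp_apply, this]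
    exact hP.trunc_fst _ ((hk (Fin.le_last _)).trans hkn) _
  trunc_snd l hl x := by
    have := trunc_blockMap a hk x ⟨l, by omega⟩
    simp only [blockPair, Seminorm.comp_apply, this]
    exact hP.trunc_snd _ ((hk (Fin.le_last _)).trans hkn) _
  snd_le x := hP.snd_le _

theorem blockPair_mem {ca cb : ℝ} {E : Fam 𝕜} (hE : StableFam ca cb E) {n m : ℕ}
    {P : SNPair 𝕜 n} (hP : P ∈ E n) {a : Fin n → 𝕜} {k : Fin (m + 1) → ℕ} (hk0 : k 0 = 0)
    (hk : StrictMono k) (hkn : k (Fin.last m) ≤ n) (hone : ∀ j, P.1 (piece a k j) = 1) :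
    blockPair P a k ∈ E m :=
  hE.2.2 n m P hP _ (memB_blockPair (hE.1 n P hP) hk.monotone hkn hone)
    ⟨a, k, hk0, hk, hkn, hone, fun _ => rfl, fun _ => rfl⟩

/-- Every successive decomposition of a vector is a combination of normalized pieces: vanishing
pieces are replaced by unit vectors. -/
theorem exists_normalized_pieces {ca cb : ℝ} {n m : ℕ} {P : SNPair 𝕜 n} (hP : MemB ca cb P)
    (x : Fin n → 𝕜) {k : Fin (m + 1) → ℕ} (hk : StrictMono k) (hkn : k (Fin.last m) ≤ n) :
    ∃ a : Fin n → 𝕜, (∀ j, P.1 (piece a k j) = 1) ∧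
      ∀ j, ((P.1 (piece x k j) : ℝ) : 𝕜) • piece a k j = piece x k j := by
  have hlt : ∀ j : Fin m, k j.castSucc < k j.succ := fun j => hk (Fin.castSucc_lt_succ)
  have hn : ∀ j : Fin m, k j.castSucc < n := fun j =>
    (hlt j).trans_le ((hk.monotone (Fin.le_last _)).trans hkn)
  let u : Fin m → Fin n → 𝕜 := fun j =>
    if P.1 (piece x k j) = 0 then Pi.single ⟨k j.castSucc, hn j⟩ 1
    else ((P.1 (piece x k j) : ℝ) : 𝕜)⁻¹ • piece x k j
  have hu : ∀ (j : Fin m) (i : Fin n), ¬ (k j.castSucc ≤ (i : ℕ) ∧ (i : ℕ) < k j.succ) → u j i = 0 := by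
    intro j i hi
    simp only [u]
    split_ifs
    · refine Pi.single_eq_of_ne ?_ _
      rintro rfl
      exact hi ⟨le_rfl, hlt j⟩
    · simp [piece, hi]
  have hpiece : ∀ j, piece (∑ l, u l) k j = u j := by
    intro j
    ext i
    by_cases hi : k j.castSucc ≤ (i : ℕ) ∧ (i : ℕ) < k j.succ
    · simp only [piece, hi, and_self, if_true, Finset.sum_apply]
      refine Finset.sum_eq_single j (fun l _ hl => hu l i fun h => hl ?_) (by simp)
      exact index_unique hk.monotone h hi
    · simp [piece, hi, hu j i hi]
  refine ⟨∑ l, u l, fun j => ?_, fun j => ?_⟩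
  · rw [hpiece]
    simp only [u]
    split_ifs with h
    · exact hP.single_eq_one _
    · rw [map_smul_eq_mul, norm_inv, RCLike.norm_ofReal, abs_of_nonneg (apply_nonneg _ _),
        inv_mul_cancel₀ h]
  · rw [hpiece]
    simp only [u]
    split_ifs with h
    · rw [hP.eq_zero_of _ h]
      simp
    · rw [smul_smul, mul_inv_cancel₀ (by exact_mod_cast h), one_smul]

theorem sum_pieces_le {ca cb : ℝ} {E : Fam 𝕜} (hE : StableFam ca cb E) {N : ℕ} {D : ℝ}
    (hD : ∀ Q ∈ E N, ∀ (c : Fin N → 𝕜) (M : ℝ), 0 ≤ M → (∀ j, ‖c j‖ ≤ M) → Q.1 c ≤ D * M)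
    {n : ℕ} {P : SNPair 𝕜 n} (hP : P ∈ E n) (x : Fin n → 𝕜) {k : Fin (N + 1) → ℕ}
    (hk0 : k 0 = 0) (hk : StrictMono k) (hkn : k (Fin.last N) ≤ n) {M : ℝ} (hM : 0 ≤ M)
    (hx : ∀ j, P.1 (piece x k j) ≤ M) : P.1 (∑ j, piece x k j) ≤ D * M := by
  obtain ⟨a, hone, ha⟩ := exists_normalized_pieces (hE.1 n P hP) x hk hkn
  have := hD _ (blockPair_mem hE hP hk0 hk hkn hone)
    (fun j => ((P.1 (piece x k j) : ℝ) : 𝕜)) M hM fun j => by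
      rw [RCLike.norm_ofReal, abs_of_nonneg (apply_nonneg _ _)]
      exact hx j
  simpa only [blockPair, Seminorm.comp_apply, blockMap_apply, ha] using this

theorem exists_card_filter_lt_eq {n : ℕ} (A : Finset (Fin n)) {v : ℕ} (hv : v ≤ A.card) :
    ∃ t ≤ n, (A.filter fun i : Fin n => (i : ℕ) < t).card = v := by
  have key : ∀ m ≤ n, ∀ v ≤ (A.filter fun i : Fin n => (i : ℕ) < m).card,
      ∃ t ≤ m, (A.filter fun i : Fin n => (i : ℕ) < t).card = v := by
    intro m
    induction m with
    | zero =>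
      intro _ v hv
      exact ⟨0, le_rfl, by simp at hv ⊢; omega⟩
    | succ m ih =>
      intro hm v hv
      rcases hv.eq_or_lt with h | h
      · exact ⟨m + 1, le_rfl, h.symm⟩
      · have hsub : (A.filter fun i : Fin n => (i : ℕ) < m + 1) ⊆
            insert ⟨m, hm⟩ (A.filter fun i : Fin n => (i : ℕ) < m) := by
          intro i hi
          simp only [Finset.mem_filter, Finset.mem_insert, Fin.ext_iff] at hi ⊢
          have := hi.1
          by_cases him : (i : ℕ) = m
          · exact Or.inl him
          · exact Or.inr ⟨hi.1, by omega⟩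
        have hc := (Finset.card_le_card hsub).trans (Finset.card_insert_le _ _)
        obtain ⟨t, ht, htv⟩ := ih (by omega) v (by omega)
        exact ⟨t, by omega, htv⟩
  refine key n le_rfl v ?_
  rwa [Finset.filter_true_of_mem fun i _ => i.2]

/-- A finite set of `N * q` indices can be cut into `N` successive parts of `q` indices each. -/
theorem exists_equal_cuts {n N q : ℕ} (hq : 0 < q) (A : Finset (Fin n)) (hA : A.card = N * q) :
    ∃ k : Fin (N + 1) → ℕ, k 0 = 0 ∧ StrictMono k ∧ k (Fin.last N) ≤ n ∧
      (∀ j : Fin N,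
        (A.filter fun i : Fin n => k j.castSucc ≤ (i : ℕ) ∧ (i : ℕ) < k j.succ).card = q) ∧
      ∀ i ∈ A, ∃ j : Fin N, k j.castSucc ≤ (i : ℕ) ∧ (i : ℕ) < k j.succ := by
  have hex : ∀ j : Fin (N + 1), ∃ t, (t ≤ n ∧
      (A.filter fun i : Fin n => (i : ℕ) < t).card = j * q) ∧ (j = 0 → t = 0) := by
    intro j
    by_cases hj : j = 0
    · exact ⟨0, by simp [hj], fun _ => rfl⟩
    · have : (j : ℕ) * q ≤ A.card := hA ▸ Nat.mul_le_mul_right _ (by omega)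
      obtain ⟨t, ht, h⟩ := exists_card_filter_lt_eq A this
      exact ⟨t, ⟨ht, h⟩, fun h => absurd h hj⟩
  choose k hk hk0 using hex
  have hmono : StrictMono k := by
    intro j l hjl
    by_contra! hle
    have h1 : (A.filter fun i : Fin n => (i : ℕ) < k l).card ≤ (A.filter fun i : Fin n => (i : ℕ) < k j).card :=
      Finset.card_le_card fun i hi => by
        simp only [Finset.mem_filter] at hi ⊢
        exact ⟨hi.1, by omega⟩
    rw [(hk j).2, (hk l).2] at h1
    have : (j : ℕ) < l := hjl
    exact absurd (Nat.le_of_mul_le_mul_right h1 hq) (by omega)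
  refine ⟨k, hk0 0 rfl, hmono, (hk _).1, fun j => ?_, fun i hi => ?_⟩
  · have hlt : k j.castSucc < k j.succ := hmono Fin.castSucc_lt_succ
    have hunion : (A.filter fun i : Fin n => (i : ℕ) < k j.succ) =
        (A.filter fun i : Fin n => (i : ℕ) < k j.castSucc) ∪
          (A.filter fun i : Fin n => k j.castSucc ≤ (i : ℕ) ∧ (i : ℕ) < k j.succ) := by
      ext i
      simp only [Finset.mem_filter, Finset.mem_union]
      constructor
      · rintro ⟨h1, h2⟩
        by_cases h : (i : ℕ) < k j.castSucc
        · exact Or.inl ⟨h1, h⟩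
        · exact Or.inr ⟨h1, by omega, h2⟩
      · rintro (⟨h1, h2⟩ | ⟨h1, h2⟩)
        · exact ⟨h1, by omega⟩
        · exact ⟨h1, h2.2⟩
    have hdisj : Disjoint (A.filter fun i : Fin n => (i : ℕ) < k j.castSucc)
        (A.filter fun i : Fin n => k j.castSucc ≤ (i : ℕ) ∧ (i : ℕ) < k j.succ) := by
      rw [Finset.disjoint_left]
      intro i h1 h2
      simp only [Finset.mem_filter] at h1 h2
      omega
    have hcard := congrArg Finset.card hunion
    rw [Finset.card_union_of_disjoint hdisj, (hk _).2, (hk _).2] at hcard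
    simp only [Fin.val_succ, Fin.val_castSucc, add_mul, one_mul] at hcard
    omega
  · have hlast : (i : ℕ) < k (Fin.last N) := by
      have h : (A.filter fun i : Fin n => (i : ℕ) < k (Fin.last N)) = A :=
        Finset.eq_of_subset_of_card_le (Finset.filter_subset _ _)
          (by rw [(hk _).2, hA]; simp)
      rw [← h] at hi
      exact (Finset.mem_filter.1 hi).2
    have key : ∀ l : Fin (N + 1), (i : ℕ) < k l →
        ∃ j : Fin N, k j.castSucc ≤ (i : ℕ) ∧ (i : ℕ) < k j.succ := by
      intro l
      induction l using Fin.induction with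
      | zero => intro h; rw [hk0 0 rfl] at h; omega
      | succ j ih =>
        intro h
        by_cases h' : (i : ℕ) < k j.castSucc
        · exact ih h'
        · exact ⟨j, by omega, h⟩
    exact key _ hlast

theorem sum_piece_eq {n m : ℕ} {x : Fin n → 𝕜} {k : Fin (m + 1) → ℕ} (hk : Monotone k)
    (hx : ∀ i, x i ≠ 0 → ∃ j : Fin m, k j.castSucc ≤ (i : ℕ) ∧ (i : ℕ) < k j.succ) :
    ∑ j, piece x k j = x := by
  have h : ∑ j, piece x k j = blockMap x k fun _ => 1 := by simp [blockMap_apply]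
  rw [h]
  ext i
  by_cases hi : x i = 0
  · simp [blockMap_apply, piece, hi]
  · obtain ⟨j, hj⟩ := hx i hi
    simp [blockMap_apply_of_mem x hk _ hj]

theorem le_pow_mul_of_card_eq {ca cb : ℝ} {E : Fam 𝕜} (hE : StableFam ca cb E) {N : ℕ}
    (hN : 0 < N) {D : ℝ} (hD0 : 0 ≤ D)
    (hD : ∀ Q ∈ E N, ∀ (c : Fin N → 𝕜) (M : ℝ), 0 ≤ M → (∀ j, ‖c j‖ ≤ M) → Q.1 c ≤ D * M)
    {n : ℕ} {P : SNPair 𝕜 n} (hP : P ∈ E n) {M : ℝ} (hM : 0 ≤ M) (m : ℕ) :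
    ∀ (A : Finset (Fin n)) (x : Fin n → 𝕜), A.card = N ^ m → (∀ i, x i ≠ 0 → i ∈ A) →
      (∀ i, ‖x i‖ ≤ M) → P.1 x ≤ D ^ m * M := by
  induction m with
  | zero =>
    intro A x hA hxA hx
    obtain ⟨i, rfl⟩ := Finset.card_eq_one.1 (by simpa using hA)
    refine ((hE.1 n P hP).le_sum_norm x).trans ?_
    rw [Finset.sum_eq_single i (fun j _ hj => ?_) (by simp)]
    · simpa using hx i
    · by_contra h
      exact hj (by simpa using hxA j (by simpa using h))
  | succ m ih =>
    intro A x hA hxA hx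
    obtain ⟨k, hk0, hk, hkn, hcard, hcover⟩ :=
      exists_equal_cuts (N := N) (q := N ^ m) (by positivity) A (by rw [hA, pow_succ'])
    rw [← sum_piece_eq hk.monotone fun i hi => hcover i (hxA i hi)]
    refine (sum_pieces_le hE hD hP x hk0 hk hkn (M := D ^ m * M) (by positivity)
      fun j => ih _ _ (hcard j) (fun i hi => ?_) fun i => ?_).trans_eq (by ring)
    · simp only [piece, ne_eq, ite_eq_right_iff, Classical.not_imp] at hi
      exact Finset.mem_filter.2 ⟨hxA i hi.2, hi.1⟩
    · simp only [piece]
      split_ifs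
      · exact hx i
      · simpa using hM

theorem le_mul_pow_mul_of_card_le {ca cb : ℝ} {E : Fam 𝕜} (hE : StableFam ca cb E) {N : ℕ}
    (hN : 0 < N) {D : ℝ} (hD0 : 0 ≤ D)
    (hD : ∀ Q ∈ E N, ∀ (c : Fin N → 𝕜) (M : ℝ), 0 ≤ M → (∀ j, ‖c j‖ ≤ M) → Q.1 c ≤ D * M)
    {n : ℕ} {P : SNPair 𝕜 n} (hP : P ∈ E n) {M : ℝ} (hM : 0 ≤ M) {m : ℕ} (hm : N ^ m ≤ n)
    (l : ℕ) : ∀ (A : Finset (Fin n)) (x : Fin n → 𝕜), A.card ≤ l * N ^ m →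
      (∀ i, x i ≠ 0 → i ∈ A) → (∀ i, ‖x i‖ ≤ M) → P.1 x ≤ l * (D ^ m * M) := by
  induction l with
  | zero =>
    intro A x hA hxA _
    have hA0 : A = ∅ := by simpa using hA
    have : x = 0 := by
      ext i
      by_contra h
      simpa [hA0] using hxA i h
    simp [this]
  | succ l ih =>
    intro A x hA hxA hx
    obtain ⟨A', hA'A, hA'⟩ := Finset.exists_subset_card_eq (min_le_left A.card (N ^ m))
    obtain ⟨B, hA'B, hB⟩ := Finset.exists_superset_card_eq (s := A') (n := N ^ m)
      (by omega) (by simpa using hm)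
    let y : Fin n → 𝕜 := fun i => if i ∈ A' then x i else 0
    let z : Fin n → 𝕜 := fun i => if i ∈ A' then 0 else x i
    have hxyz : x = y + z := by
      ext i
      by_cases hi : i ∈ A' <;> simp [y, z, hi]
    have hy : P.1 y ≤ D ^ m * M := by
      refine le_pow_mul_of_card_eq hE hN hD0 hD hP hM m B y hB (fun i hi => hA'B ?_) fun i => ?_
      · by_contra h
        simp [y, h] at hi
      · by_cases hi : i ∈ A' <;> simp [y, hi, hx i, hM]
    have hz : P.1 z ≤ l * (D ^ m * M) := by
      refine ih (A \ A') z ?_ (fun i hi => ?_) fun i => ?_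
      · rw [Finset.card_sdiff_of_subset hA'A, hA']
        rw [add_mul, one_mul] at hA
        omega
      · by_cases h : i ∈ A'
        · simp [z, h] at hi
        · simp only [z, h, if_false] at hi
          exact Finset.mem_sdiff.2 ⟨hxA i hi, h⟩
      · by_cases hi : i ∈ A' <;> simp [z, hi, hx i, hM]
    calc P.1 x ≤ P.1 y + P.1 z := by rw [hxyz]; exact map_add_le_add _ _ _
      _ ≤ D ^ m * M + l * (D ^ m * M) := add_le_add hy hz
      _ = ((l + 1 : ℕ) : ℝ) * (D ^ m * M) := by push_cast; ring

theorem card_lt_norm_le {n : ℕ} {x : Fin n → 𝕜} {s L w : ℝ} (hs : 0 < s) (hL : 0 < L)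
    (hw : 0 < w) (hx : ∑ i, ‖x i‖ ^ s ≤ L ^ s) :
    ((Finset.univ.filter fun i => L * w < ‖x i‖).card : ℝ) ≤ w ^ (-s) := by
  have h : ((Finset.univ.filter fun i => L * w < ‖x i‖).card : ℝ) * (L * w) ^ s ≤ L ^ s := by
    refine le_trans ?_ hx
    rw [← nsmul_eq_mul]
    refine (Finset.card_nsmul_le_sum _ (fun i => ‖x i‖ ^ s) _ fun i hi => ?_).trans
      (Finset.sum_le_sum_of_subset_of_nonneg (Finset.filter_subset _ _)
        fun i _ _ => Real.rpow_nonneg (norm_nonneg _) _)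
    exact Real.rpow_le_rpow (by positivity) (Finset.mem_filter.1 hi).2.le hs.le
  rw [Real.mul_rpow hL.le hw.le, mul_left_comm] at h
  have hLs : 0 < L ^ s := Real.rpow_pos_of_pos hL _
  have hws : 0 < w ^ s := Real.rpow_pos_of_pos hw _
  rw [Real.rpow_neg hw.le, ← one_div, le_div_iff₀ hws]
  exact le_of_mul_le_mul_left (by linarith) hLs

/-- The level sets of `x` are estimated separately and summed geometrically; `w` is the ratio of
consecutive levels. -/
theorem le_geometric_mul {ca cb : ℝ} {E : Fam 𝕜} (hE : StableFam ca cb E) {N : ℕ}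
    (hN : 1 < N) {D : ℝ} (hD0 : 0 ≤ D)
    (hD : ∀ Q ∈ E N, ∀ (c : Fin N → 𝕜) (M : ℝ), 0 ≤ M → (∀ j, ‖c j‖ ≤ M) → Q.1 c ≤ D * M)
    {s w : ℝ} (hs : 0 < s) (hw : 0 < w) (hws : w ^ (-s) = N) (hDw : D * w < 1)
    {n : ℕ} (hn : 1 ≤ n) {P : SNPair 𝕜 n} (hP : P ∈ E n) {x : Fin n → 𝕜} {L : ℝ} (hL : 0 < L)
    (hx : ∑ i, ‖x i‖ ^ s ≤ L ^ s) : P.1 x ≤ N / (1 - D * w) * L := by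
  have hN0 : 0 < N := by omega
  let y : ℕ → Fin n → 𝕜 := fun m i => if ‖x i‖ ≤ L * w ^ m then x i else 0
  have hy : ∀ m i, ‖y m i‖ ≤ L * w ^ m := by
    intro m i
    simp only [y]
    split_ifs with h
    · exact h
    · simp; positivity
  have hw1 : w ≤ 1 := by
    by_contra! h
    have h1 := Real.rpow_lt_one_of_one_lt_of_neg h (neg_lt_zero.2 hs)
    rw [hws] at h1
    have : (1 : ℝ) < N := by exact_mod_cast hN
    linarith
  have hy0 : y 0 = x := by
    ext i
    have : ‖x i‖ ≤ L := by
      refine (Real.rpow_le_rpow_iff (norm_nonneg _) hL.le hs).1 (le_trans ?_ hx)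
      exact Finset.single_le_sum (f := fun i => ‖x i‖ ^ s)
        (fun _ _ => Real.rpow_nonneg (norm_nonneg _) _) (Finset.mem_univ i)
    simp [y, this]
  have hstep : ∀ m, N ^ m ≤ n → P.1 (y m) ≤ N * L * (D * w) ^ m + P.1 (y (m + 1)) := by
    intro m hm
    have hdiff : P.1 (y m - y (m + 1)) ≤ N * (D ^ m * (L * w ^ m)) := by
      refine le_mul_pow_mul_of_card_le hE hN0 hD0 hD hP (by positivity) hm N
        (Finset.univ.filter fun i => L * w ^ (m + 1) < ‖x i‖) _ ?_ (fun i hi => ?_) fun i => ?_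
      · have h := card_lt_norm_le hs hL (pow_pos hw (m + 1)) hx
        have hpow : (w ^ (m + 1)) ^ (-s) = (N : ℝ) * N ^ m := by
          rw [← Real.rpow_natCast_mul hw.le, mul_comm, Real.rpow_mul_natCast hw.le, hws, pow_succ']
        rw [hpow] at h
        exact_mod_cast h
      · simp only [Finset.mem_filter, Finset.mem_univ, true_and]
        by_contra! h
        have h' : ‖x i‖ ≤ L * w ^ m :=
          h.trans (mul_le_mul_of_nonneg_left
            (pow_le_pow_of_le_one hw.le hw1 (Nat.le_succ m)) hL.le)
        simp [y, h, h'] at hi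
      · by_cases h : ‖x i‖ ≤ L * w ^ (m + 1)
        · have h' : ‖x i‖ ≤ L * w ^ m :=
            h.trans (mul_le_mul_of_nonneg_left
              (pow_le_pow_of_le_one hw.le hw1 (Nat.le_succ m)) hL.le)
          simp [y, h, h']
          positivity
        · have : (y m - y (m + 1)) i = y m i := by simp [y, h]
          rw [this]
          exact hy m i
    calc P.1 (y m) = P.1 ((y m - y (m + 1)) + y (m + 1)) := by rw [sub_add_cancel]
      _ ≤ P.1 (y m - y (m + 1)) + P.1 (y (m + 1)) := map_add_le_add _ _ _
      _ ≤ N * L * (D * w) ^ m + P.1 (y (m + 1)) := by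
          rw [mul_pow]
          linarith
  have hiter : ∀ m, N ^ m ≤ n →
      P.1 x ≤ N * L * ∑ i ∈ Finset.range m, (D * w) ^ i + P.1 (y m) := by
    intro m
    induction m with
    | zero => intro _; simp [hy0]
    | succ m ih =>
      intro hm
      have hm' : N ^ m ≤ n := (Nat.pow_le_pow_right hN0 (Nat.le_succ m)).trans hm
      rw [Finset.sum_range_succ, mul_add]
      linarith [ih hm', hstep m hm']
  have hK : N ^ Nat.log N n ≤ n := Nat.pow_log_le_self N (by omega)
  have hK' : n ≤ N * N ^ Nat.log N n := by
    rw [← pow_succ']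
    exact (Nat.lt_pow_succ_log_self hN n).le
  have hlast : P.1 (y (Nat.log N n)) ≤ N * (D ^ Nat.log N n * (L * w ^ Nat.log N n)) :=
    le_mul_pow_mul_of_card_le hE hN0 hD0 hD hP (by positivity) hK N Finset.univ _
      (by simpa using hK') (fun i _ => Finset.mem_univ i) (hy _)
  have hgeom : ∑ i ∈ Finset.range (Nat.log N n + 1), (D * w) ^ i ≤ (1 - D * w)⁻¹ := by
    rw [← tsum_geometric_of_lt_one (by positivity) hDw]
    exact (summable_geometric_of_lt_one (by positivity) hDw).sum_le_tsum _
      fun _ _ => by positivity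
  calc P.1 x ≤ N * L * ∑ i ∈ Finset.range (Nat.log N n), (D * w) ^ i
        + N * (D ^ Nat.log N n * (L * w ^ Nat.log N n)) := (hiter _ hK).trans (by gcongr)
    _ = N * L * ∑ i ∈ Finset.range (Nat.log N n + 1), (D * w) ^ i := by
        rw [Finset.sum_range_succ, mul_pow]
        ring
    _ ≤ N * L * (1 - D * w)⁻¹ := by gcongr
    _ = N / (1 - D * w) * L := by ring

end Blocks

/-- Proposition 2.7(i): if `E` is an identity block, `N > 1` and
`1 ≤ p ≤ r < ∞` satisfy `α_{r,N}(E) ≤ N^{1/p − 1/r}`, then `E` has block basic type `s`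
for every `1 ≤ s < p`, i.e. `sup_n α_{s,n}(E) < ∞`. -/
theorem block_basic_type_of_alpha_bound {𝕜 : Type*} [RCLike 𝕜]
    (ca cb : ℝ) (hca : 0 ≤ ca) (hcb : 1 ≤ cb)
    (E : Fam 𝕜) (hE : IdentityBlockFam ca cb E)
    (N : ℕ) (hN : 1 < N) (p r : ℝ) (hp : 1 ≤ p) (hpr : p ≤ r)
    (hα : alphaC (ENNReal.ofReal r) E N ≤ (N : ℝ) ^ (1 / p - 1 / r)) :
    ∀ s : ℝ, 1 ≤ s → s < p →
      ∃ C : ℝ, ∀ n : ℕ, 1 ≤ n → alphaC (ENNReal.ofReal s) E n ≤ C := by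
  intro s hs hsp
  have hN1 : (1 : ℝ) < N := by exact_mod_cast hN
  have hN0 : (0 : ℝ) < N := by positivity
  have hr0 : 0 < r := by linarith
  have hs0 : 0 < s := by linarith
  have hD : ∀ Q ∈ E N, ∀ (c : Fin N → 𝕜) (M : ℝ), 0 ≤ M → (∀ j, ‖c j‖ ≤ M) →
      Q.1 c ≤ (N : ℝ) ^ (1 / p) * M := by
    intro Q hQ c M hM hc
    rw [hE.2 N Q hQ]
    calc Q.2 c ≤ alphaC (ENNReal.ofReal r) E N * lpnorm (ENNReal.ofReal r) c :=
          le_alphaC_mul_lpnorm hE hr0 hQ c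
      _ ≤ (N : ℝ) ^ (1 / p - 1 / r) * ((N : ℝ) ^ (1 / r) * M) :=
          mul_le_mul hα (lpnorm_le_of_norm_le hr0 hM hc) (lpnorm_nonneg_s4 hr0.le c)
            (by positivity)
      _ = (N : ℝ) ^ (1 / p) * M := by
          rw [← mul_assoc, ← Real.rpow_add hN0, sub_add_cancel]
  have hDw : (N : ℝ) ^ (1 / p) * (N : ℝ) ^ (-(1 / s)) < 1 := by
    rw [← Real.rpow_add hN0]
    refine Real.rpow_lt_one_of_one_lt_of_neg hN1 ?_
    have := one_div_lt_one_div_of_lt hs0 hsp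
    linarith
  have hws : ((N : ℝ) ^ (-(1 / s))) ^ (-s) = N := by
    rw [← Real.rpow_mul hN0.le, neg_mul_neg, one_div_mul_cancel hs0.ne', Real.rpow_one]
  refine ⟨N / (1 - (N : ℝ) ^ (1 / p) * (N : ℝ) ^ (-(1 / s))), fun n hn => ?_⟩
  refine csInf_le ⟨0, fun T hT => hT.1.le⟩ ⟨div_pos hN0 (by linarith), fun P hP x => ?_⟩
  rw [← hE.2 n P hP]
  rcases (lpnorm_nonneg_s4 hs0.le x).eq_or_lt with h0 | hpos
  · have hx : x = 0 := by
      ext i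
      have := norm_le_lpnorm_s4 hs0 x i
      rw [← h0] at this
      simpa using this
    rw [← h0, hx]
    simp
  · refine le_geometric_mul hE.1 hN (by positivity) hD hs0 (by positivity) hws hDw hn hP hpos ?_
    rw [lpnorm_ofReal hs0.le, ← Real.rpow_mul (sum_rpow_nonneg s x),
      one_div_mul_cancel hs0.ne', Real.rpow_one]

end AsymSeminorms
end
end
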